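/- arXiv:1702.04575 — 2 statements merged into one kernel-verified Lean document; each statement's English description precedes it below -/
import Mathlib

section
/- Let S = (S_i) and R = (R_i) be collections of subsets of ℤ, and let A and B be nonnegatively graded k-algebras generated in degrees 0 and 1 with semisimple degree-0 part. If X is an S-determined graded A-module and Y is an R-determined graded B-module, then X⊗_k Y is an (S⊗R)-determined graded module over A⊗_k B. In particular, if A and B are Koszul algebras, then A⊗_k B is Koszul. -/
universe u

variable (k : Type u) [Field k]

/-- A ℤ-graded module over a `k`-algebra `R` equipped with a family
`𝒜 : ℤ → Submodule k R` of graded components. -/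
structure GrMod (R : Type u) [Ring R] [Algebra k R] (𝒜 : ℤ → Submodule k R) :
    Type (u + 1) where
  /-- the underlying type -/
  carrier : Type u
  [acg : AddCommGroup carrier]
  [modk : Module k carrier]
  [modR : Module R carrier]
  /-- the `k`-action is the restriction of the `R`-action along `algebraMap k R` -/
  central : ∀ (c : k) (x : carrier), (algebraMap k R c) • x = c • x
  /-- the grading -/
  grading : ℤ → Submodule k carrier
  /-- the grading decomposes the module as an internal direct sum -/
  isInternal : DirectSum.IsInternal grading
  /-- the grading is compatible with the grading of `R` -/
  smul_mem : ∀ {i j : ℤ} {a : R} {x : carrier},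
      a ∈ 𝒜 i → x ∈ grading j → a • x ∈ grading (i + j)

attribute [instance] GrMod.acg GrMod.modk GrMod.modR

namespace GrMod

variable {k} {R : Type u} [Ring R] [Algebra k R] {𝒜 : ℤ → Submodule k R}

/-- A degree-zero morphism of graded modules. -/
structure Hom (M N : GrMod k R 𝒜) where
  /-- the underlying `R`-linear map -/
  toLin : M.carrier →ₗ[R] N.carrier
  /-- it preserves degrees -/
  map_grading : ∀ (i : ℤ) (x : M.carrier), x ∈ M.grading i → toLin x ∈ N.grading i

/-- A graded module is generated in degrees belonging to `T` if it is generated, as a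
module, by its homogeneous components of degrees in `T`. -/
def GeneratedIn (M : GrMod k R 𝒜) (T : Set ℤ) : Prop :=
  Submodule.span R (⋃ j ∈ T, ((M.grading j : Submodule k M.carrier) : Set M.carrier)) = ⊤

/-- A graded projective resolution `⋯ → P₁ → P₀ → X → 0` of a graded module `X`. -/
structure ProjRes (X : GrMod k R 𝒜) where
  /-- the terms of the resolution -/
  P : ℕ → GrMod k R 𝒜
  /-- the differentials -/
  d : ∀ n : ℕ, Hom (P (n + 1)) (P n)
  /-- the augmentation -/
  aug : Hom (P 0) X
  /-- each term is projective -/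
  projective : ∀ n, Module.Projective R (P n).carrier
  /-- the augmentation is surjective -/
  surj : Function.Surjective aug.toLin
  /-- exactness at `P₀` -/
  exact0 : Function.Exact (d 0).toLin aug.toLin
  /-- exactness at `P_{n+1}` -/
  exactS : ∀ n, Function.Exact (d (n + 1)).toLin (d n).toLin

/-- A graded module `X` is `S`-determined if it admits a graded projective resolution whose
`n`-th term is generated in degrees belonging to `S n`. -/
def SDetermined (S : ℕ → Set ℤ) (X : GrMod k R 𝒜) : Prop :=
  ∃ Rres : ProjRes X, ∀ n : ℕ, GeneratedIn (Rres.P n) (S n)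

/-- Vanishing of `Ext^i` in the category of graded modules: on any graded projective
resolution of `X`, every degree-`i` cocycle with values in `Y` is a coboundary. -/
def ExtVanishes (X Y : GrMod k R 𝒜) (i : ℕ) : Prop :=
  ∀ Rres : ProjRes X,
    match i with
    | 0 => ∀ f : Hom (Rres.P 0) Y,
        (∀ z, f.toLin ((Rres.d 0).toLin z) = 0) → f.toLin = 0
    | (n + 1) => ∀ f : Hom (Rres.P (n + 1)) Y,
        (∀ z, f.toLin ((Rres.d (n + 1)).toLin z) = 0) →
        ∃ g : Hom (Rres.P n) Y, ∀ z, f.toLin z = g.toLin ((Rres.d n).toLin z)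

end GrMod

/-- The grading on a tensor product of two graded algebras. -/
def tensorGrading {A B : Type u} [Ring A] [Algebra k A] [Ring B] [Algebra k B]
    (𝒜 : ℤ → Submodule k A) (ℬ : ℤ → Submodule k B) (n : ℤ) :
    Submodule k (TensorProduct k A B) :=
  Submodule.span k {z | ∃ (i j : ℤ) (a : A) (b : B),
    a ∈ 𝒜 i ∧ b ∈ ℬ j ∧ i + j = n ∧ z = a ⊗ₜ[k] b}

/-- The grading on the opposite algebra induced by a grading. -/
def opGrading {A : Type u} [Ring A] [Algebra k A] (𝒜 : ℤ → Submodule k A) (n : ℤ) :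
    Submodule k Aᵐᵒᵖ :=
  (𝒜 n).map (MulOpposite.opLinearEquiv k).toLinearMap

/-- The tensor product of two collections of subsets of `ℤ`:
`(S ⊗ R)_i = ⋃_{j+k=i} { n + m ∣ n ∈ S_j, m ∈ R_k }`. -/
def collTensor (S R : ℕ → Set ℤ) (i : ℕ) : Set ℤ :=
  ⋃ (j : ℕ) (k : ℕ) (_ : j + k = i), {d | ∃ n ∈ S j, ∃ m ∈ R k, d = n + m}

/-- The standing hypotheses of the paper on a graded algebra: nonnegatively graded,
degree-zero part a finite product of copies of `k`, finite-dimensional degree-one part,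
generated in degrees `0` and `1`. -/
def StdGraded {A : Type u} [Ring A] [Algebra k A] (𝒜 : ℤ → Submodule k A) : Prop :=
  (∀ i : ℤ, i < 0 → 𝒜 i = ⊥) ∧
  FiniteDimensional k (𝒜 1) ∧
  (∃ (n : ℕ) (e : (𝒜 0) ≃ₗ[k] (Fin n → k)),
    ∀ (x y : A) (hx : x ∈ 𝒜 0) (hy : y ∈ 𝒜 0) (hxy : x * y ∈ 𝒜 0),
      e ⟨x * y, hxy⟩ = e ⟨x, hx⟩ * e ⟨y, hy⟩) ∧
  (∀ n : ℤ, 1 ≤ n → (𝒜 (n + 1) : Submodule k A) =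
    Submodule.span k {x | ∃ a ∈ 𝒜 n, ∃ b ∈ 𝒜 1, x = a * b})
open scoped TensorProduct

namespace GrMod

variable {k : Type u} [Field k]

section Lemmas

variable {R : Type u} [Ring R] [Algebra k R] {𝒜 : ℤ → Submodule k R}

/-- The action of a ring element on a graded module, as a `k`-linear map. -/
def smulLin (M : GrMod k R 𝒜) (r : R) : M.carrier →ₗ[k] M.carrier where
  toFun x := r • x
  map_add' x y := smul_add r x y
  map_smul' c x := by
    simp only [RingHom.id_apply]
    rw [← M.central c x, ← M.central c (r • x), ← mul_smul, ← mul_smul,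
      Algebra.commutes c r]

@[simp] lemma smulLin_apply (M : GrMod k R 𝒜) (r : R) (x : M.carrier) :
    M.smulLin r x = r • x := rfl

/-- The underlying `k`-linear map of an `R`-linear map between graded modules. -/
def kLin {M N : GrMod k R 𝒜} (f : M.carrier →ₗ[R] N.carrier) :
    M.carrier →ₗ[k] N.carrier where
  toFun := f
  map_add' := f.map_add
  map_smul' c x := by
    simp only [RingHom.id_apply]
    rw [← M.central c x, ← N.central c (f x)]
    exact f.map_smul _ x

@[simp] lemma kLin_apply {M N : GrMod k R 𝒜} (f : M.carrier →ₗ[R] N.carrier)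
    (x : M.carrier) : kLin f x = f x := rfl

end Lemmas

section Restrict

variable {A B : Type u} [Ring A] [Algebra k A] [Ring B] [Algebra k B]
  {𝒜 : ℤ → Submodule k A} {ℬ : ℤ → Submodule k B}

/-- Restriction of a graded `A ⊗ B`-module (e.g. a graded bimodule) to a graded `B`-module,
provided `1 ∈ 𝒜 0`. -/
noncomputable def restrictRight (h1 : (1 : A) ∈ 𝒜 0)
    (X : GrMod k (A ⊗[k] B) (tensorGrading k 𝒜 ℬ)) : GrMod k B ℬ where
  carrier := X.carrier
  modR := Module.compHom X.carrier
    (Algebra.TensorProduct.includeRight : B →ₐ[k] A ⊗[k] B).toRingHom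
  central c x := by
    show ((Algebra.TensorProduct.includeRight : B →ₐ[k] A ⊗[k] B)
      (algebraMap k B c)) • x = c • x
    rw [(Algebra.TensorProduct.includeRight : B →ₐ[k] A ⊗[k] B).commutes c]
    exact X.central c x
  grading := X.grading
  isInternal := X.isInternal
  smul_mem {i j b x} hb hx := by
    show ((Algebra.TensorProduct.includeRight : B →ₐ[k] A ⊗[k] B) b) • x ∈
      X.grading (i + j)
    exact X.smul_mem (Submodule.subset_span ⟨0, i, 1, b, h1, hb, zero_add i, rfl⟩) hx

/-- Restriction of a graded `A ⊗ B`-module to a graded `A`-module, provided `1 ∈ ℬ 0`. -/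
noncomputable def restrictLeft (h1 : (1 : B) ∈ ℬ 0)
    (X : GrMod k (A ⊗[k] B) (tensorGrading k 𝒜 ℬ)) : GrMod k A 𝒜 where
  carrier := X.carrier
  modR := Module.compHom X.carrier
    (Algebra.TensorProduct.includeLeft : A →ₐ[k] A ⊗[k] B).toRingHom
  central c x := by
    show ((Algebra.TensorProduct.includeLeft : A →ₐ[k] A ⊗[k] B)
      (algebraMap k A c)) • x = c • x
    rw [(Algebra.TensorProduct.includeLeft : A →ₐ[k] A ⊗[k] B).commutes c]
    exact X.central c x
  grading := X.grading
  isInternal := X.isInternal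
  smul_mem {i j a x} ha hx := by
    show ((Algebra.TensorProduct.includeLeft : A →ₐ[k] A ⊗[k] B) a) • x ∈
      X.grading (i + j)
    have : (a ⊗ₜ[k] (1 : B)) ∈ tensorGrading k 𝒜 ℬ i :=
      Submodule.subset_span ⟨i, 0, a, 1, ha, h1, add_zero i, rfl⟩
    exact X.smul_mem this hx

end Restrict

section Balanced

variable {A B C : Type u} [Ring A] [Algebra k A] [Ring B] [Algebra k B]
  [Ring C] [Algebra k C]
  {𝒜 : ℤ → Submodule k A} {ℬ : ℤ → Submodule k B} {𝒞 : ℤ → Submodule k C}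

/-- The submodule of relations defining the balanced tensor product `X ⊗_B Y` of a graded
`A`-`B`-bimodule `X` (a module over `A ⊗ Bᵐᵒᵖ`) and a graded `B`-`C`-bimodule `Y`
(a module over `B ⊗ Cᵐᵒᵖ`). -/
def balRel (X : GrMod k (A ⊗[k] Bᵐᵒᵖ) (tensorGrading k 𝒜 (opGrading k ℬ)))
    (Y : GrMod k (B ⊗[k] Cᵐᵒᵖ) (tensorGrading k ℬ (opGrading k 𝒞))) :
    Submodule k (X.carrier ⊗[k] Y.carrier) :=
  Submodule.span k {z | ∃ (b : B) (x : X.carrier) (y : Y.carrier),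
    z = (((1 : A) ⊗ₜ[k] MulOpposite.op b) • x) ⊗ₜ[k] y -
        x ⊗ₜ[k] ((b ⊗ₜ[k] (1 : Cᵐᵒᵖ)) • y)}

/-- The balanced tensor product `X ⊗_B Y` as a `k`-module. -/
abbrev balT (X : GrMod k (A ⊗[k] Bᵐᵒᵖ) (tensorGrading k 𝒜 (opGrading k ℬ)))
    (Y : GrMod k (B ⊗[k] Cᵐᵒᵖ) (tensorGrading k ℬ (opGrading k 𝒞))) : Type u :=
  (X.carrier ⊗[k] Y.carrier) ⧸ balRel X Y

/-- The map induced on balanced tensor products by a pair of `k`-linear maps commuting with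
the `B`-actions. -/
noncomputable def balMap {X X' : GrMod k (A ⊗[k] Bᵐᵒᵖ) (tensorGrading k 𝒜 (opGrading k ℬ))}
    {Y Y' : GrMod k (B ⊗[k] Cᵐᵒᵖ) (tensorGrading k ℬ (opGrading k 𝒞))}
    (g : X.carrier →ₗ[k] X'.carrier) (h : Y.carrier →ₗ[k] Y'.carrier)
    (hg : ∀ (b : B) (x : X.carrier),
      g (((1 : A) ⊗ₜ[k] MulOpposite.op b) • x) = ((1 : A) ⊗ₜ[k] MulOpposite.op b) • g x)
    (hh : ∀ (b : B) (y : Y.carrier),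
      h ((b ⊗ₜ[k] (1 : Cᵐᵒᵖ)) • y) = (b ⊗ₜ[k] (1 : Cᵐᵒᵖ)) • h y) :
    balT X Y →ₗ[k] balT X' Y' :=
  Submodule.mapQ (balRel X Y) (balRel X' Y') (TensorProduct.map g h) (by
    rw [balRel, Submodule.span_le]
    rintro z ⟨b, x, y, rfl⟩
    simp only [SetLike.mem_coe, Submodule.mem_comap, map_sub, TensorProduct.map_tmul, hg, hh]
    exact Submodule.subset_span ⟨b, g x, h y, rfl⟩)

/-- The degree-`n` part of the canonical grading on the balanced tensor product. -/
noncomputable def balGrading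
    (X : GrMod k (A ⊗[k] Bᵐᵒᵖ) (tensorGrading k 𝒜 (opGrading k ℬ)))
    (Y : GrMod k (B ⊗[k] Cᵐᵒᵖ) (tensorGrading k ℬ (opGrading k 𝒞))) (n : ℤ) :
    Submodule k (balT X Y) :=
  (Submodule.span k {z | ∃ (i j : ℤ) (x : X.carrier) (y : Y.carrier),
    x ∈ X.grading i ∧ y ∈ Y.grading j ∧ i + j = n ∧ z = x ⊗ₜ[k] y}).map (balRel X Y).mkQ

end Balanced

end GrMod

namespace GrMod

section LinearAlgebra

variable {k} {P Q : ℕ → Type u} [∀ n, AddCommGroup (P n)] [∀ n, Module k (P n)]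
  [∀ n, AddCommGroup (Q n)] [∀ n, Module k (Q n)]

/-- A resolution over a field has a contracting homotopy. -/
lemma exists_contraction {X : Type u} [AddCommGroup X] [Module k X]
    (d : ∀ n, P (n + 1) →ₗ[k] P n) (ε : P 0 →ₗ[k] X) (hε : Function.Surjective ε)
    (h0 : Function.Exact (d 0) ε) (hS : ∀ n, Function.Exact (d (n + 1)) (d n)) :
    ∃ (σ : X →ₗ[k] P 0) (s : ∀ n, P n →ₗ[k] P (n + 1)),
      d 0 ∘ₗ s 0 + σ ∘ₗ ε = LinearMap.id ∧
      ∀ n, d (n + 1) ∘ₗ s (n + 1) + s n ∘ₗ d n = LinearMap.id := by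
  obtain ⟨σ, hσ⟩ := ε.exists_rightInverse_of_surjective (LinearMap.range_eq_top.2 hε)
  choose g hg using fun n => (d n).rangeRestrict.exists_rightInverse_of_surjective
    (LinearMap.range_rangeRestrict _)
  choose p hp using fun n => (LinearMap.range (d n)).subtype.exists_leftInverse_of_injective
    (Submodule.ker_subtype _)
  have hdg : ∀ n, ∀ x ∈ LinearMap.range (d n), d n (g n (p n x)) = x := fun n x hx => by
    have h1 : p n x = ⟨x, hx⟩ := LinearMap.congr_fun (hp n) ⟨x, hx⟩
    rw [h1]
    exact congrArg Subtype.val (LinearMap.congr_fun (hg n) ⟨x, hx⟩)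
  have hdd : ∀ n x, d n (d (n + 1) x) = 0 := fun n x => (hS n).apply_apply_eq_zero x
  have hσ' : ∀ x, ε (σ x) = x := LinearMap.congr_fun hσ
  let s : ∀ n, P n →ₗ[k] P (n + 1) := fun n => match n with
    | 0 => g 0 ∘ₗ p 0 ∘ₗ (LinearMap.id - σ ∘ₗ ε)
    | n + 1 => g (n + 1) ∘ₗ p (n + 1) ∘ₗ (LinearMap.id - (g n ∘ₗ p n) ∘ₗ d n)
  have hs : ∀ n x, s n (d n x) = g n (p n (d n x)) := by
    rintro (_ | n) x
    · simp [s, h0.apply_apply_eq_zero]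
    · simp [s, hdd]
  refine ⟨σ, s, LinearMap.ext fun x => ?_, fun n => LinearMap.ext fun x => ?_⟩
  · have := hdg 0 (x - σ (ε x)) ((h0 _).1 (by simp [hσ']))
    change d 0 (g 0 (p 0 (x - σ (ε x)))) + σ (ε x) = x
    rw [this, sub_add_cancel]
  · have := hdg (n + 1) (x - g n (p n (d n x))) ((hS n _).1 (by simp [hdg]))
    change d (n + 1) (g (n + 1) (p (n + 1) (x - g n (p n (d n x))))) + s n (d n x) = x
    rw [this, hs, sub_add_cancel]

/-- The differential of the total complex of a tensor product of two complexes. -/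
def totalD (d : ∀ n, P (n + 1) →ₗ[k] P n) (d' : ∀ n, Q (n + 1) →ₗ[k] Q n) {n : ℕ}
    (f : ∀ a b, a + b = n + 1 → P a ⊗[k] Q b) (a b : ℕ) (h : a + b = n) : P a ⊗[k] Q b :=
  TensorProduct.map (d a) LinearMap.id (f (a + 1) b (by omega)) +
    (-1 : ℤ) ^ a • TensorProduct.map LinearMap.id (d' b) (f a (b + 1) (by omega))

variable (d : ∀ n, P (n + 1) →ₗ[k] P n) (d' : ∀ n, Q (n + 1) →ₗ[k] Q n)

lemma totalD_totalD (hd : ∀ n, d n ∘ₗ d (n + 1) = 0) (hd' : ∀ n, d' n ∘ₗ d' (n + 1) = 0) {n : ℕ}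
    (f : ∀ a b, a + b = n + 1 + 1 → P a ⊗[k] Q b) (a b : ℕ) (h : a + b = n) :
    totalD d d' (totalD d d' f) a b h = 0 := by
  simp only [totalD, map_add, map_zsmul, ← LinearMap.comp_apply, ← TensorProduct.map_comp, hd, hd',
    LinearMap.id_comp, LinearMap.comp_id, TensorProduct.map_zero_left,
    TensorProduct.map_zero_right, LinearMap.zero_apply, smul_zero, pow_succ, smul_add]
  simp

/-- Exactness of the total complex of a tensor product of two contractible augmented complexes. -/
lemma exists_totalD_eq {e : P 0 →ₗ[k] P 0} {s : ∀ n, P n →ₗ[k] P (n + 1)}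
    {e' : Q 0 →ₗ[k] Q 0} {t : ∀ n, Q n →ₗ[k] Q (n + 1)} (he : e ∘ₗ d 0 = 0)
    (hs0 : d 0 ∘ₗ s 0 + e = LinearMap.id)
    (hs : ∀ n, d (n + 1) ∘ₗ s (n + 1) + s n ∘ₗ d n = LinearMap.id)
    (ht0 : d' 0 ∘ₗ t 0 + e' = LinearMap.id)
    (ht : ∀ n, d' (n + 1) ∘ₗ t (n + 1) + t n ∘ₗ d' n = LinearMap.id) {n : ℕ}
    (f : ∀ a b, a + b = n → P a ⊗[k] Q b)
    (hf : ∀ m (hm : m + 1 = n) a b (h : a + b = m),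
      totalD d d' (n := m) (fun a b h => f a b (h.trans hm)) a b h = 0)
    (hf0 : ∀ h : 0 + 0 = n, TensorProduct.map e e' (f 0 0 h) = 0) :
    ∃ g : ∀ a b, a + b = n + 1 → P a ⊗[k] Q b, ∀ a b h, totalD d d' g a b h = f a b h := by
  let g : ∀ a b, a + b = n + 1 → P a ⊗[k] Q b := fun a b => match a, b with
    | a + 1, b => fun h => TensorProduct.map (s a) LinearMap.id (f a b (by omega))
    | 0, b + 1 => fun h => TensorProduct.map e (t b) (f 0 b (by omega))
    | 0, 0 => fun h => absurd h (by omega)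
  have split : ∀ {a b : ℕ} {u v : P a →ₗ[k] P a} (x : P a ⊗[k] Q b), u + v = LinearMap.id →
      TensorProduct.map u LinearMap.id x + TensorProduct.map v LinearMap.id x = x := by
    intro a b u v x h
    rw [← LinearMap.add_apply, ← TensorProduct.map_add_left, h, TensorProduct.map_id,
      LinearMap.id_apply]
  have split' : ∀ {a b : ℕ} {w : P a →ₗ[k] P a} {u v : Q b →ₗ[k] Q b} (x : P a ⊗[k] Q b),
      u + v = LinearMap.id → TensorProduct.map w u x + TensorProduct.map w v x =
        TensorProduct.map w LinearMap.id x := by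
    intro a b w u v x h
    rw [← LinearMap.add_apply, ← TensorProduct.map_add_right, h]
  refine ⟨g, fun a b h => ?_⟩
  rcases a with _ | a
  · have h1 := split (f 0 b h) hs0
    have h2 : TensorProduct.map e (d' b ∘ₗ t b) (f 0 b h) =
        TensorProduct.map e LinearMap.id (f 0 b h) := by
      rcases b with _ | b
      · rw [← split' _ ht0, hf0, add_zero]
      · have h3 := congrArg (TensorProduct.map e (t b)) (hf b (by omega) 0 b (by omega))
        simp only [totalD, map_add, ← LinearMap.comp_apply, ← TensorProduct.map_comp,
          he, TensorProduct.map_zero_left, LinearMap.comp_id, LinearMap.zero_apply, pow_zero,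
          one_smul, zero_add, map_zero] at h3
        rw [← split' _ (ht b)]
        simpa using h3
    simp only [totalD, g, pow_zero, one_smul, ← LinearMap.comp_apply, ← TensorProduct.map_comp,
      LinearMap.comp_id, LinearMap.id_comp]
    rw [h2, h1]
  · have h1 := split (f (a + 1) b h) (hs a)
    have h3 := congrArg (TensorProduct.map (s a) LinearMap.id)
      (hf (a + b) (by omega) a b rfl)
    simp only [totalD, map_add, map_zsmul, ← LinearMap.comp_apply, ← TensorProduct.map_comp,
      LinearMap.comp_id, LinearMap.id_comp, map_zero] at h3
    simp only [totalD, g, ← LinearMap.comp_apply, ← TensorProduct.map_comp,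
      LinearMap.comp_id, LinearMap.id_comp, pow_succ, mul_neg, mul_one, neg_smul]
    rwa [eq_neg_of_add_eq_zero_left h3] at h1

end LinearAlgebra

section TensorResolution

variable {k} {A B : Type u} [Ring A] [Algebra k A] [Ring B] [Algebra k B]
  {𝒜 : ℤ → Submodule k A} {ℬ : ℤ → Submodule k B}

instance isScalarTower_carrier (M : GrMod k A 𝒜) : IsScalarTower k A M.carrier :=
  ⟨fun c a x => by rw [Algebra.smul_def, mul_smul, M.central]⟩

/-- A family of submodules spanning the whole module is a grading as soon as there is a linear
map sending every `x` in the component of degree `n` to `single n x`. -/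
lemma isInternal_of_coaction {V : Type*} [AddCommGroup V] [Module k V] (G : ℤ → Submodule k V)
    (δ : V →ₗ[k] (ℤ →₀ V)) (hδ : ∀ n, ∀ x ∈ G n, δ x = Finsupp.single n x)
    (htop : iSup G = ⊤) : DirectSum.IsInternal G := by
  rw [DirectSum.isInternal_submodule_iff_iSupIndep_and_iSup_eq_top]
  refine ⟨fun n => Submodule.disjoint_def.2 fun x hx hx' => ?_, htop⟩
  have hker : (⨆ m, ⨆ (_ : m ≠ n), G m) ≤ LinearMap.ker (Finsupp.lapply n ∘ₗ δ) := by
    refine iSup₂_le fun m hm y hy => ?_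
    simp [hδ m y hy, hm]
  have h0 := hker hx'
  simpa [hδ n x hx] using h0

/-- The map sending every homogeneous `x` of degree `n` to `single n x`. -/
lemma exists_coaction (M : GrMod k A 𝒜) : ∃ δ : M.carrier →ₗ[k] (ℤ →₀ M.carrier),
    ∀ n, ∀ x ∈ M.grading n, δ x = Finsupp.single n x := by
  let E := LinearEquiv.ofBijective (DirectSum.coeLinearMap M.grading) M.isInternal
  refine ⟨DirectSum.toModule k ℤ _ (fun n => Finsupp.lsingle n ∘ₗ (M.grading n).subtype) ∘ₗ
    E.symm.toLinearMap, fun n x hx => ?_⟩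
  have hE : E.symm x = DirectSum.lof k ℤ (fun n => M.grading n) n ⟨x, hx⟩ := by
    rw [LinearEquiv.symm_apply_eq]
    exact (DirectSum.coeLinearMap_lof M.grading n ⟨x, hx⟩).symm
  simp [hE]

lemma iSup_grading (M : GrMod k A 𝒜) : iSup M.grading = ⊤ :=
  ((DirectSum.isInternal_submodule_iff_iSupIndep_and_iSup_eq_top _).1 M.isInternal).2

/-- The degree-`n` part of the tensor product of two graded modules. -/
def tensorDeg (M : GrMod k A 𝒜) (N : GrMod k B ℬ) (n : ℤ) :
    Submodule k (M.carrier ⊗[k] N.carrier) :=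
  Submodule.span k {z | ∃ (i j : ℤ) (x : M.carrier) (y : N.carrier),
    x ∈ M.grading i ∧ y ∈ N.grading j ∧ i + j = n ∧ z = x ⊗ₜ[k] y}

lemma tmul_mem_tensorDeg {M : GrMod k A 𝒜} {N : GrMod k B ℬ} {i j : ℤ} {x : M.carrier}
    {y : N.carrier} (hx : x ∈ M.grading i) (hy : y ∈ N.grading j) :
    x ⊗ₜ[k] y ∈ tensorDeg M N (i + j) :=
  Submodule.subset_span ⟨i, j, x, y, hx, hy, rfl, rfl⟩

lemma isInternal_tensorDeg (M : GrMod k A 𝒜) (N : GrMod k B ℬ) :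
    DirectSum.IsInternal (tensorDeg M N) := by
  classical
  obtain ⟨δM, hM⟩ := M.exists_coaction
  obtain ⟨δN, hN⟩ := N.exists_coaction
  refine isInternal_of_coaction _ (Finsupp.lmapDomain _ k (fun p : ℤ × ℤ => p.1 + p.2) ∘ₗ
    (finsuppTensorFinsupp k k M.carrier N.carrier ℤ ℤ).toLinearMap ∘ₗ
      TensorProduct.map δM δN) (fun n z hz => ?_) ?_
  · induction hz using Submodule.span_induction with
    | mem z hz =>
      obtain ⟨i, j, x, y, hx, hy, rfl, rfl⟩ := hz
      simp [hM i x hx, hN j y hy]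
    | zero => simp
    | add z w _ _ hz hw => rw [map_add, hz, hw, Finsupp.single_add]
    | smul c z _ hz => rw [map_smul, hz, Finsupp.smul_single]
  · rw [eq_top_iff, ← TensorProduct.span_tmul_eq_top, Submodule.span_le]
    rintro _ ⟨x, y, rfl⟩
    have hx : x ∈ iSup M.grading := by rw [iSup_grading]; trivial
    have hy : y ∈ iSup N.grading := by rw [iSup_grading]; trivial
    rw [SetLike.mem_coe]
    induction hx using Submodule.iSup_induction' with
    | zero => simp
    | add x x' _ _ h h' => rw [TensorProduct.add_tmul]; exact add_mem h h'
    | mem i x hx =>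
      induction hy using Submodule.iSup_induction' with
      | zero => simp
      | add y y' _ _ h h' => rw [TensorProduct.tmul_add]; exact add_mem h h'
      | mem j y hy => exact Submodule.mem_iSup_of_mem (i + j) (tmul_mem_tensorDeg hx hy)

/-- The action of `A ⊗ B` on the tensor product of an `A`-module and a `B`-module. -/
noncomputable def tensorAct (M : GrMod k A 𝒜) (N : GrMod k B ℬ) :
    A ⊗[k] B →ₐ[k] Module.End k (M.carrier ⊗[k] N.carrier) :=
  Module.endTensorEndAlgHom.comp
    (Algebra.TensorProduct.map (Algebra.lsmul k k M.carrier) (Algebra.lsmul k k N.carrier))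

lemma tensorAct_tmul (M : GrMod k A 𝒜) (N : GrMod k B ℬ) (a : A) (b : B) (x : M.carrier)
    (y : N.carrier) : tensorAct M N (a ⊗ₜ b) (x ⊗ₜ y) = (a • x) ⊗ₜ (b • y) := rfl

/-- The tensor product of two graded modules. -/
noncomputable def tensor (M : GrMod k A 𝒜) (N : GrMod k B ℬ) :
    GrMod k (A ⊗[k] B) (tensorGrading k 𝒜 ℬ) where
  carrier := M.carrier ⊗[k] N.carrier
  modR := Module.compHom _ (tensorAct M N).toRingHom
  central c z := by
    change tensorAct M N (algebraMap k _ c) z = c • z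
    rw [AlgHom.commutes, Module.algebraMap_end_apply]
  grading := tensorDeg M N
  isInternal := isInternal_tensorDeg M N
  smul_mem {i j r z} hr hz := by
    change tensorAct M N r z ∈ _
    induction hr using Submodule.span_induction with
    | zero => simp
    | add r r' _ _ h h' => rw [map_add]; exact add_mem h h'
    | smul c r _ h => rw [map_smul]; exact Submodule.smul_mem _ _ h
    | mem r hr =>
      obtain ⟨s, t, a, b, ha, hb, rfl, rfl⟩ := hr
      induction hz using Submodule.span_induction with
      | zero => simp
      | add z z' _ _ h h' => rw [map_add]; exact add_mem h h'
      | smul c z _ h => rw [map_smul]; exact Submodule.smul_mem _ _ h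
      | mem z hz =>
        obtain ⟨p, q, x, y, hx, hy, rfl, rfl⟩ := hz
        rw [tensorAct_tmul, add_add_add_comm]
        exact tmul_mem_tensorDeg (M.smul_mem ha hx) (N.smul_mem hb hy)

/-- The identification of the carrier of `tensor M N` with the tensor product over `k`. -/
noncomputable def tensorEquiv (M : GrMod k A 𝒜) (N : GrMod k B ℬ) :
    M.carrier ⊗[k] N.carrier ≃ₗ[k] (tensor M N).carrier :=
  LinearEquiv.refl k _

lemma tensor_grading (M : GrMod k A 𝒜) (N : GrMod k B ℬ) (n : ℤ) :
    (tensor M N).grading n = (tensorDeg M N n).map (tensorEquiv M N).toLinearMap :=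
  (Submodule.map_id _).symm

lemma tensorEquiv_mem_grading {M : GrMod k A 𝒜} {N : GrMod k B ℬ} {n : ℤ}
    {z : M.carrier ⊗[k] N.carrier} (hz : z ∈ tensorDeg M N n) :
    tensorEquiv M N z ∈ (tensor M N).grading n := hz

lemma tmul_smul_tensorEquiv (M : GrMod k A 𝒜) (N : GrMod k B ℬ) (a : A) (b : B) (x : M.carrier)
    (y : N.carrier) :
    (a ⊗ₜ[k] b) • tensorEquiv M N (x ⊗ₜ[k] y) = tensorEquiv M N ((a • x) ⊗ₜ[k] (b • y)) := rfl

/-- A `k`-linear map out of a tensor product is `A ⊗ B`-linear if it commutes with the action of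
pure tensors on pure tensors. -/
lemma map_smul_of_tmul {M : GrMod k A 𝒜} {N : GrMod k B ℬ} {W : Type*} [AddCommGroup W]
    [Module k W] [Module (A ⊗[k] B) W] (f : M.carrier ⊗[k] N.carrier →ₗ[k] W)
    (hf : ∀ (a : A) (b : B) (x : M.carrier) (y : N.carrier),
      f ((a • x) ⊗ₜ (b • y)) = (a ⊗ₜ[k] b) • f (x ⊗ₜ y))
    (r : A ⊗[k] B) (z : (tensor M N).carrier) :
    f ((tensorEquiv M N).symm (r • z)) = r • f ((tensorEquiv M N).symm z) := by
  induction r using TensorProduct.induction_on with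
  | zero => simp
  | add r r' h h' => simp only [add_smul, map_add, h, h']
  | tmul a b =>
    obtain ⟨w, rfl⟩ := (tensorEquiv M N).surjective z
    induction w using TensorProduct.induction_on with
    | zero => simp
    | add z z' h h' => simp only [map_add, smul_add, h, h']
    | tmul x y => simp [tmul_smul_tensorEquiv, hf]

/-- The `A ⊗ B`-linear map induced by a `k`-linear map commuting with the action of pure tensors
on pure tensors. -/
noncomputable def tensorLift {M : GrMod k A 𝒜} {N : GrMod k B ℬ} {W : Type*} [AddCommGroup W]
    [Module k W] [Module (A ⊗[k] B) W] (f : M.carrier ⊗[k] N.carrier →ₗ[k] W)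
    (hf : ∀ (a : A) (b : B) (x : M.carrier) (y : N.carrier),
      f ((a • x) ⊗ₜ (b • y)) = (a ⊗ₜ[k] b) • f (x ⊗ₜ y)) :
    (tensor M N).carrier →ₗ[A ⊗[k] B] W where
  toFun z := f ((tensorEquiv M N).symm z)
  map_add' z w := by simp
  map_smul' := map_smul_of_tmul f hf

@[simp] lemma tensorLift_tensorEquiv {M : GrMod k A 𝒜} {N : GrMod k B ℬ} {W : Type*}
    [AddCommGroup W] [Module k W] [Module (A ⊗[k] B) W] (f : M.carrier ⊗[k] N.carrier →ₗ[k] W)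
    (hf : ∀ (a : A) (b : B) (x : M.carrier) (y : N.carrier),
      f ((a • x) ⊗ₜ (b • y)) = (a ⊗ₜ[k] b) • f (x ⊗ₜ y)) (z : M.carrier ⊗[k] N.carrier) :
    tensorLift f hf (tensorEquiv M N z) = f z := by
  simp [tensorLift]

lemma tensorEquiv_map_smul {M M' : GrMod k A 𝒜} {N N' : GrMod k B ℬ} (f : Hom M M')
    (g : Hom N N') (a : A) (b : B) (x : M.carrier) (y : N.carrier) :
    ((tensorEquiv M' N').toLinearMap ∘ₗ TensorProduct.map (kLin f.toLin) (kLin g.toLin))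
      ((a • x) ⊗ₜ (b • y)) = (a ⊗ₜ[k] b) •
        ((tensorEquiv M' N').toLinearMap ∘ₗ TensorProduct.map (kLin f.toLin) (kLin g.toLin))
          (x ⊗ₜ y) := by
  simp [tmul_smul_tensorEquiv]

/-- The tensor product of two morphisms of graded modules. -/
noncomputable def tensorHom {M M' : GrMod k A 𝒜} {N N' : GrMod k B ℬ} (f : Hom M M')
    (g : Hom N N') : Hom (tensor M N) (tensor M' N') where
  toLin := tensorLift ((tensorEquiv M' N').toLinearMap ∘ₗ
    TensorProduct.map (kLin f.toLin) (kLin g.toLin)) (tensorEquiv_map_smul f g)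
  map_grading n z hz := by
    rw [tensor_grading] at hz
    obtain ⟨z, hz, rfl⟩ := hz
    rw [LinearEquiv.coe_coe, tensorLift_tensorEquiv, LinearMap.comp_apply]
    refine tensorEquiv_mem_grading ?_
    induction hz using Submodule.span_induction with
    | zero => simp
    | add z z' _ _ h h' => rw [map_add]; exact add_mem h h'
    | smul c z _ h => rw [map_smul]; exact Submodule.smul_mem _ _ h
    | mem z hz =>
      obtain ⟨p, q, x, y, hx, hy, rfl, rfl⟩ := hz
      exact tmul_mem_tensorDeg (f.map_grading _ _ hx) (g.map_grading _ _ hy)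

lemma tensorHom_tensorEquiv {M M' : GrMod k A 𝒜} {N N' : GrMod k B ℬ} (f : Hom M M')
    (g : Hom N N') (z : M.carrier ⊗[k] N.carrier) :
    (tensorHom f g).toLin (tensorEquiv M N z) =
      tensorEquiv M' N' (TensorProduct.map (kLin f.toLin) (kLin g.toLin) z) := by
  simp [tensorHom]

lemma projective_tensor (M : GrMod k A 𝒜) (N : GrMod k B ℬ) (hM : Module.Projective A M.carrier)
    (hN : Module.Projective B N.carrier) : Module.Projective (A ⊗[k] B) (tensor M N).carrier := by
  classical
  obtain ⟨s, hs⟩ := Module.projective_def'.1 hM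
  obtain ⟨t, ht⟩ := Module.projective_def'.1 hN
  let i : M.carrier ⊗[k] N.carrier →ₗ[k] (M.carrier × N.carrier →₀ A ⊗[k] B) :=
    (finsuppTensorFinsupp k k A B M.carrier N.carrier).toLinearMap ∘ₗ
      TensorProduct.map (s.restrictScalars k) (t.restrictScalars k)
  let v : M.carrier × N.carrier → (tensor M N).carrier := fun p => tensorEquiv M N (p.1 ⊗ₜ[k] p.2)
  have key : ∀ (f : M.carrier →₀ A) (g : N.carrier →₀ B),
      Finsupp.linearCombination (A ⊗[k] B) v (finsuppTensorFinsupp k k A B _ _ (f ⊗ₜ g)) =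
        tensorEquiv M N
          (Finsupp.linearCombination A id f ⊗ₜ[k] Finsupp.linearCombination B id g) := by
    intro f g
    induction f using Finsupp.induction_linear with
    | zero => simp
    | add f f' h h' => simp only [TensorProduct.add_tmul, map_add, h, h']
    | single m a =>
      induction g using Finsupp.induction_linear with
      | zero => simp
      | add g g' h h' => simp only [TensorProduct.tmul_add, map_add, h, h']
      | single n b => simp [v, tmul_smul_tensorEquiv]
  refine Module.Projective.of_split (tensorLift i fun a b x y => ?_)
    (Finsupp.linearCombination (A ⊗[k] B) v) (LinearMap.ext fun z => ?_)
  · ext ⟨p, q⟩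
    simp [i, finsuppTensorFinsupp_apply]
  · obtain ⟨z, rfl⟩ := (tensorEquiv M N).surjective z
    rw [LinearMap.comp_apply, tensorLift_tensorEquiv, LinearMap.id_apply]
    induction z using TensorProduct.induction_on with
    | zero => simp
    | add z z' h h' => simp only [map_add, h, h']
    | tmul x y =>
      refine (key (s x) (t y)).trans (congrArg _ ?_)
      exact congrArg₂ _ (LinearMap.congr_fun hs x) (LinearMap.congr_fun ht y)

lemma generatedIn_tensor {M : GrMod k A 𝒜} {N : GrMod k B ℬ} {S R : Set ℤ}
    (hM : GeneratedIn M S) (hN : GeneratedIn N R) :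
    GeneratedIn (tensor M N) {d | ∃ n ∈ S, ∃ m ∈ R, d = n + m} := by
  rw [GeneratedIn, eq_top_iff]
  set U := Submodule.span (A ⊗[k] B) (⋃ j ∈ {d | ∃ n ∈ S, ∃ m ∈ R, d = n + m},
    (((tensor M N).grading j : Submodule k _) : Set (tensor M N).carrier))
  have key : ∀ (x : M.carrier) (y : N.carrier), tensorEquiv M N (x ⊗ₜ[k] y) ∈ U := by
    intro x y
    have hx : x ∈ Submodule.span A (⋃ j ∈ S, (M.grading j : Set M.carrier)) := by
      rw [hM]; trivial
    have hy : y ∈ Submodule.span B (⋃ j ∈ R, (N.grading j : Set N.carrier)) := by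
      rw [hN]; trivial
    induction hx using Submodule.span_induction with
    | zero => simp
    | add x x' _ _ h h' => rw [TensorProduct.add_tmul, map_add]; exact U.add_mem h h'
    | smul a x _ h =>
      have h1 := U.smul_mem (a ⊗ₜ[k] (1 : B)) h
      rwa [tmul_smul_tensorEquiv, one_smul] at h1
    | mem x hx =>
      induction hy using Submodule.span_induction with
      | zero => simp
      | add y y' _ _ h h' => rw [TensorProduct.tmul_add, map_add]; exact U.add_mem h h'
      | smul b y _ h =>
        have h1 := U.smul_mem ((1 : A) ⊗ₜ[k] b) h
        rwa [tmul_smul_tensorEquiv, one_smul] at h1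
      | mem y hy =>
        simp only [Set.mem_iUnion, SetLike.mem_coe] at hx hy
        obtain ⟨i, hi, hx⟩ := hx
        obtain ⟨j, hj, hy⟩ := hy
        exact Submodule.subset_span (Set.mem_biUnion ⟨i, hi, j, hj, rfl⟩
          (tensorEquiv_mem_grading (tmul_mem_tensorDeg hx hy)))
  intro z _
  obtain ⟨z, rfl⟩ := (tensorEquiv M N).surjective z
  induction z using TensorProduct.induction_on with
  | zero => simp
  | add z z' h h' => rw [map_add]; exact U.add_mem (h trivial) (h' trivial)
  | tmul x y => exact key x y

/-- The product of a finite family of graded modules. -/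
def pi {ι : Type} [Finite ι] (M : ι → GrMod k A 𝒜) : GrMod k A 𝒜 where
  carrier := ∀ i, (M i).carrier
  central c x := funext fun i => (M i).central c (x i)
  grading n := Submodule.pi Set.univ fun i => (M i).grading n
  isInternal := by
    classical
    have := Fintype.ofFinite ι
    choose δ hδ using fun i => (M i).exists_coaction
    refine isInternal_of_coaction _ (∑ i, Finsupp.mapRange.linearMap
      (LinearMap.single k (fun i => (M i).carrier) i) ∘ₗ δ i ∘ₗ LinearMap.proj i)
      (fun n x hx => ?_) (eq_top_iff.2 fun x _ => ?_)
    · have hi : ∀ i, δ i (x i) = Finsupp.single n (x i) := fun i => hδ i n _ (hx i trivial)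
      simp only [LinearMap.sum_apply, LinearMap.comp_apply, LinearMap.proj_apply, hi,
        Finsupp.mapRange.linearMap_apply, Finsupp.mapRange_single, LinearMap.coe_single]
      rw [← Finsupp.single_finsetSum, Finset.univ_sum_single]
    · rw [← Finset.univ_sum_single x]
      refine sum_mem fun i _ => ?_
      have hx : x i ∈ iSup (M i).grading := by rw [iSup_grading]; trivial
      generalize x i = y at hx
      induction hx using Submodule.iSup_induction' with
      | zero => rw [Pi.single_zero]; exact zero_mem _
      | add y z _ _ hy hz => rw [Pi.single_add]; exact add_mem hy hz
      | mem n y hy =>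
        refine Submodule.mem_iSup_of_mem n fun j _ => ?_
        obtain rfl | hij := eq_or_ne i j
        · simpa using hy
        · rw [Pi.single_eq_of_ne' hij]
          exact zero_mem _
  smul_mem ha hx i _ := (M i).smul_mem ha (hx i trivial)

section Pi

variable {ι : Type} [Finite ι] (M : ι → GrMod k A 𝒜)

/-- The identification of the carrier of `pi M` with the product of the carriers. -/
def piEquiv : (∀ i, (M i).carrier) ≃ₗ[A] (pi M).carrier := LinearEquiv.refl A _

lemma piEquiv_mem_grading {n : ℤ} {x : ∀ i, (M i).carrier} :
    piEquiv M x ∈ (pi M).grading n ↔ ∀ i, x i ∈ (M i).grading n :=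
  Submodule.mem_pi.trans (by simp; rfl)

lemma projective_pi (h : ∀ i, Module.Projective A (M i).carrier) :
    Module.Projective A (pi M).carrier := by
  classical
  have := Fintype.ofFinite ι
  exact Module.Projective.of_equiv' ((DFinsupp.linearEquivFunOnFintype
    (R := A) (M := fun i => (M i).carrier)).trans (piEquiv M))

lemma generatedIn_pi {M : ι → GrMod k A 𝒜} {T : Set ℤ} (h : ∀ i, GeneratedIn (M i) T) :
    GeneratedIn (pi M) T := by
  classical
  have := Fintype.ofFinite ι
  rw [GeneratedIn, eq_top_iff]
  intro x _
  obtain ⟨x, rfl⟩ := (piEquiv M).surjective x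
  rw [← Finset.univ_sum_single x, map_sum]
  refine sum_mem fun i _ => ?_
  have hx : x i ∈ Submodule.span A (⋃ j ∈ T, ((M i).grading j : Set (M i).carrier)) := by
    rw [h i]; trivial
  generalize x i = y at hx
  induction hx using Submodule.span_induction with
  | zero => simp
  | add y z _ _ hy hz => rw [Pi.single_add, map_add]; exact add_mem hy hz
  | smul a y _ hy => rw [Pi.single_smul, map_smul]; exact Submodule.smul_mem _ _ hy
  | mem y hy =>
    simp only [Set.mem_iUnion, SetLike.mem_coe] at hy
    obtain ⟨n, hn, hy⟩ := hy
    refine Submodule.subset_span (Set.mem_biUnion hn ((piEquiv_mem_grading M).2 fun j => ?_))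
    obtain rfl | hij := eq_or_ne i j
    · simpa using hy
    · rw [Pi.single_eq_of_ne' hij]
      exact zero_mem _

lemma GeneratedIn.mono {M : GrMod k A 𝒜} {T T' : Set ℤ} (h : GeneratedIn M T) (hT : T ⊆ T') :
    GeneratedIn M T' :=
  eq_top_iff.2 (h.ge.trans (Submodule.span_mono (Set.biUnion_subset_biUnion_left hT)))

end Pi

section Total

variable {X : GrMod k A 𝒜} {Y : GrMod k B ℬ} (U : ProjRes X) (V : ProjRes Y)

instance finite_antidiagonal (n : ℕ) : Finite {p : ℕ × ℕ // p.1 + p.2 = n} :=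
  Set.Finite.to_subtype (s := {p : ℕ × ℕ | p.1 + p.2 = n})
    ((Finset.HasAntidiagonal.antidiagonal n).finite_toSet.subset fun p hp => by simpa using hp)

/-- The terms of the total complex of the tensor product of two resolutions. -/
noncomputable def totalObj (n : ℕ) : GrMod k (A ⊗[k] B) (tensorGrading k 𝒜 ℬ) :=
  pi fun p : {p : ℕ × ℕ // p.1 + p.2 = n} => tensor (U.P p.1.1) (V.P p.1.2)

/-- The element of the total complex with given coordinates. -/
noncomputable def totalOf {n : ℕ}
    (f : ∀ a b, a + b = n → (U.P a).carrier ⊗[k] (V.P b).carrier) : (totalObj U V n).carrier :=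
  piEquiv (fun p : {p : ℕ × ℕ // p.1 + p.2 = n} => tensor (U.P p.1.1) (V.P p.1.2))
    fun p => tensorEquiv _ _ (f p.1.1 p.1.2 p.2)

lemma totalOf_surjective (n : ℕ) : Function.Surjective (totalOf U V (n := n)) := by
  intro z
  obtain ⟨z, rfl⟩ := (piEquiv fun p : {p : ℕ × ℕ // p.1 + p.2 = n} =>
    tensor (U.P p.1.1) (V.P p.1.2)).surjective z
  exact ⟨fun a b h => (tensorEquiv _ _).symm (z ⟨(a, b), h⟩),
    congrArg _ (funext fun p => LinearEquiv.apply_symm_apply _ _)⟩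

lemma totalOf_eq_zero {n : ℕ} {f : ∀ a b, a + b = n → (U.P a).carrier ⊗[k] (V.P b).carrier} :
    totalOf U V f = 0 ↔ ∀ a b h, f a b h = 0 := by
  refine (LinearEquiv.map_eq_zero_iff _).trans (funext_iff.trans
    ⟨fun h a b hab => ?_, fun h p => ?_⟩)
  · exact (tensorEquiv _ _).map_eq_zero_iff.1 (h ⟨(a, b), hab⟩)
  · exact (tensorEquiv _ _).map_eq_zero_iff.2 (h _ _ _)

lemma totalOf_mem_grading {n : ℕ} {i : ℤ}
    {f : ∀ a b, a + b = n → (U.P a).carrier ⊗[k] (V.P b).carrier} :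
    totalOf U V f ∈ (totalObj U V n).grading i ↔
      ∀ a b h, tensorEquiv _ _ (f a b h) ∈ (tensor (U.P a) (V.P b)).grading i :=
  (piEquiv_mem_grading _).trans
    ⟨fun h a b hab => h ⟨(a, b), hab⟩, fun h p => h p.1.1 p.1.2 p.2⟩

/-- The coordinates of an element of the total complex. -/
noncomputable def totalProj {n : ℕ} (a b : ℕ) (h : a + b = n) :
    (totalObj U V n).carrier →ₗ[A ⊗[k] B] (tensor (U.P a) (V.P b)).carrier :=
  LinearMap.proj (R := A ⊗[k] B) (⟨(a, b), h⟩ : {p : ℕ × ℕ // p.1 + p.2 = n}) ∘ₗ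
    (piEquiv fun p : {p : ℕ × ℕ // p.1 + p.2 = n} =>
      tensor (U.P p.1.1) (V.P p.1.2)).symm.toLinearMap

lemma totalProj_totalOf {n : ℕ} (f : ∀ a b, a + b = n → (U.P a).carrier ⊗[k] (V.P b).carrier)
    (a b : ℕ) (h : a + b = n) : totalProj U V a b h (totalOf U V f) = tensorEquiv _ _ (f a b h) :=
  rfl

/-- The identity morphism. -/
def Hom.refl (M : GrMod k A 𝒜) : Hom M M := ⟨LinearMap.id, fun _ _ h => h⟩

/-- The underlying linear map of the differential of the total complex. -/
noncomputable def totalLin (n : ℕ) :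
    (totalObj U V (n + 1)).carrier →ₗ[A ⊗[k] B] (totalObj U V n).carrier :=
  (piEquiv fun p : {p : ℕ × ℕ // p.1 + p.2 = n} =>
    tensor (U.P p.1.1) (V.P p.1.2)).toLinearMap ∘ₗ LinearMap.pi fun p =>
      (tensorHom (U.d p.1.1) (Hom.refl (V.P p.1.2))).toLin ∘ₗ
          totalProj U V (p.1.1 + 1) p.1.2 (by have := p.2; omega) +
        (-1 : ℤ) ^ p.1.1 • (tensorHom (Hom.refl (U.P p.1.1)) (V.d p.1.2)).toLin ∘ₗ
          totalProj U V p.1.1 (p.1.2 + 1) (by have := p.2; omega)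

lemma totalLin_totalOf {n : ℕ}
    (f : ∀ a b, a + b = n + 1 → (U.P a).carrier ⊗[k] (V.P b).carrier) :
    totalLin U V n (totalOf U V f) =
      totalOf U V (totalD (fun n => kLin (U.d n).toLin) (fun n => kLin (V.d n).toLin) f) := by
  refine congrArg (piEquiv _) (funext fun p => ?_)
  simp only [totalD, map_add, map_zsmul]
  rfl

/-- The differential of the total complex of the tensor product of two resolutions. -/
noncomputable def totalHom (n : ℕ) : Hom (totalObj U V (n + 1)) (totalObj U V n) where
  toLin := totalLin U V n
  map_grading i z hz := by
    obtain ⟨f, rfl⟩ := totalOf_surjective U V _ z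
    rw [totalOf_mem_grading] at hz
    rw [totalLin_totalOf, totalOf_mem_grading]
    intro a b h
    rw [totalD, map_add, map_zsmul]
    refine add_mem ?_ (zsmul_mem ?_ _)
    · have := (tensorHom (U.d a) (Hom.refl (V.P b))).map_grading i _ (hz (a + 1) b (by omega))
      rwa [tensorHom_tensorEquiv] at this
    · have := (tensorHom (Hom.refl (U.P a)) (V.d b)).map_grading i _ (hz a (b + 1) (by omega))
      rwa [tensorHom_tensorEquiv] at this

/-- The augmentation of the total complex of the tensor product of two resolutions. -/
noncomputable def totalAug : Hom (totalObj U V 0) (tensor X Y) where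
  toLin := (tensorHom U.aug V.aug).toLin ∘ₗ totalProj U V 0 0 rfl
  map_grading i z hz := by
    obtain ⟨f, rfl⟩ := totalOf_surjective U V _ z
    rw [totalOf_mem_grading] at hz
    exact (tensorHom U.aug V.aug).map_grading i _ (hz 0 0 rfl)

lemma totalAug_totalOf (f : ∀ a b, a + b = 0 → (U.P a).carrier ⊗[k] (V.P b).carrier) :
    (totalAug U V).toLin (totalOf U V f) = tensorEquiv X Y
      (TensorProduct.map (kLin U.aug.toLin) (kLin V.aug.toLin) (f 0 0 rfl)) :=
  tensorHom_tensorEquiv _ _ _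

lemma ProjRes.exists_contraction : ∃ (σ : X.carrier →ₗ[k] (U.P 0).carrier)
    (s : ∀ n, (U.P n).carrier →ₗ[k] (U.P (n + 1)).carrier),
      kLin (U.d 0).toLin ∘ₗ s 0 + σ ∘ₗ kLin U.aug.toLin = LinearMap.id ∧
      ∀ n, kLin (U.d (n + 1)).toLin ∘ₗ s (n + 1) + s n ∘ₗ kLin (U.d n).toLin = LinearMap.id :=
  GrMod.exists_contraction (P := fun n => (U.P n).carrier) (fun n => kLin (U.d n).toLin)
    (kLin U.aug.toLin) U.surj U.exact0 U.exactS

/-- The total complex of the tensor product of two resolutions is a resolution. -/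
noncomputable def ProjRes.tensor : ProjRes (GrMod.tensor X Y) where
  P := totalObj U V
  d := totalHom U V
  aug := totalAug U V
  projective n := projective_pi _ fun p =>
    projective_tensor _ _ (U.projective p.1.1) (V.projective p.1.2)
  surj z := by
    obtain ⟨z, rfl⟩ := (tensorEquiv X Y).surjective z
    obtain ⟨w, rfl⟩ := TensorProduct.map_surjective (g := kLin U.aug.toLin)
      (g' := kLin V.aug.toLin) U.surj V.surj z
    refine ⟨totalOf U V fun a b _ => match a, b with
      | 0, 0 => w
      | 0, _ + 1 => 0
      | _ + 1, _ => 0, ?_⟩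
    rw [totalAug_totalOf]
  exact0 z := by
    obtain ⟨σ, s, hs0, hs⟩ := U.exists_contraction
    obtain ⟨τ, t, ht0, ht⟩ := V.exists_contraction
    obtain ⟨f, rfl⟩ := totalOf_surjective U V _ z
    have hU : kLin U.aug.toLin ∘ₗ kLin (U.d 0).toLin = 0 :=
      LinearMap.ext fun x => U.exact0.apply_apply_eq_zero x
    have he : (σ ∘ₗ kLin U.aug.toLin) ∘ₗ kLin (U.d 0).toLin = 0 := by
      rw [LinearMap.comp_assoc, hU, LinearMap.comp_zero]
    have hV : kLin V.aug.toLin ∘ₗ kLin (V.d 0).toLin = 0 :=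
      LinearMap.ext fun x => V.exact0.apply_apply_eq_zero x
    rw [totalAug_totalOf, EmbeddingLike.map_eq_zero_iff]
    constructor
    · intro h
      have h0 : TensorProduct.map (σ ∘ₗ kLin U.aug.toLin) (τ ∘ₗ kLin V.aug.toLin)
          (f 0 0 rfl) = 0 := by
        rw [TensorProduct.map_comp, LinearMap.comp_apply, h, map_zero]
      obtain ⟨g, hg⟩ := exists_totalD_eq (fun n => kLin (U.d n).toLin)
        (fun n => kLin (V.d n).toLin) he hs0 hs ht0 ht f (fun m hm => absurd hm (by omega))
        (fun _ => h0)
      refine ⟨totalOf U V g, (totalLin_totalOf U V g).trans (congrArg _ ?_)⟩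
      funext a b h
      exact hg a b h
    · rintro ⟨w, hw⟩
      obtain ⟨g, rfl⟩ := totalOf_surjective U V _ w
      have h1 := congrArg (totalAug U V).toLin hw
      rw [totalAug_totalOf, totalHom, totalLin_totalOf, totalAug_totalOf] at h1
      rw [← (tensorEquiv X Y).injective h1]
      simp only [totalD, map_add, map_zsmul, ← LinearMap.comp_apply, ← TensorProduct.map_comp,
        hU, hV, TensorProduct.map_zero_left, TensorProduct.map_zero_right, LinearMap.zero_apply,
        smul_zero, add_zero]
  exactS n z := by
    obtain ⟨σ, s, hs0, hs⟩ := U.exists_contraction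
    obtain ⟨τ, t, ht0, ht⟩ := V.exists_contraction
    obtain ⟨f, rfl⟩ := totalOf_surjective U V _ z
    have hU : kLin U.aug.toLin ∘ₗ kLin (U.d 0).toLin = 0 :=
      LinearMap.ext fun x => U.exact0.apply_apply_eq_zero x
    have he : (σ ∘ₗ kLin U.aug.toLin) ∘ₗ kLin (U.d 0).toLin = 0 := by
      rw [LinearMap.comp_assoc, hU, LinearMap.comp_zero]
    constructor
    · intro h
      have h' := (totalOf_eq_zero U V).1 ((totalLin_totalOf U V f).symm.trans h)
      obtain ⟨g, hg⟩ := exists_totalD_eq (fun n => kLin (U.d n).toLin)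
        (fun n => kLin (V.d n).toLin) he hs0 hs ht0 ht f
        (fun m hm => by obtain rfl : m = n := Nat.succ_injective hm; exact h')
        (fun h => absurd h (by omega))
      refine ⟨totalOf U V g, (totalLin_totalOf U V g).trans (congrArg _ ?_)⟩
      funext a b h
      exact hg a b h
    · rintro ⟨w, hw⟩
      obtain ⟨g, rfl⟩ := totalOf_surjective U V _ w
      rw [← hw, totalHom, totalHom, totalLin_totalOf, totalLin_totalOf, totalOf_eq_zero]
      exact totalD_totalD _ _ (fun n => LinearMap.ext fun x => (U.exactS n).apply_apply_eq_zero x)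
        (fun n => LinearMap.ext fun x => (V.exactS n).apply_apply_eq_zero x) g

end Total

lemma SDetermined.tensor {X : GrMod k A 𝒜} {Y : GrMod k B ℬ} {S R : ℕ → Set ℤ}
    (hX : SDetermined S X) (hY : SDetermined R Y) :
    SDetermined (collTensor S R) (GrMod.tensor X Y) := by
  obtain ⟨U, hU⟩ := hX
  obtain ⟨V, hV⟩ := hY
  refine ⟨U.tensor V, fun n => generatedIn_pi fun p => ?_⟩
  refine (generatedIn_tensor (hU p.1.1) (hV p.1.2)).mono fun d hd => ?_
  simp only [collTensor, Set.mem_iUnion]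
  exact ⟨p.1.1, p.1.2, p.2, hd⟩

/-- Being `S`-determined is invariant under isomorphism of graded modules. -/
lemma SDetermined.of_equiv {X Y : GrMod k A 𝒜} {S : ℕ → Set ℤ} (hX : SDetermined S X)
    (e : X.carrier ≃ₗ[A] Y.carrier) (he : ∀ i, ∀ x ∈ X.grading i, e x ∈ Y.grading i) :
    SDetermined S Y := by
  obtain ⟨U, hU⟩ := hX
  refine ⟨{ U with
    aug := ⟨e.toLinearMap ∘ₗ U.aug.toLin, fun i x hx => he i _ (U.aug.map_grading i x hx)⟩
    surj := e.surjective.comp U.surj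
    exact0 := fun z => (map_eq_zero_iff e e.injective).trans (U.exact0 z) }, hU⟩

end TensorResolution

end GrMod

/-- if `X` is an `S`-determined graded `A`-module and `Y` an `R`-determined
graded `B`-module, then `X ⊗_k Y` is an `(S ⊗ R)`-determined graded `A ⊗ B`-module (`Q` is
"the" graded `A ⊗ B`-module `X ⊗_k Y`, characterized by the `k`-linear isomorphism `e`).
In particular the tensor product of Koszul algebras is Koszul. -/
theorem tensor_sDetermined {k : Type u} [Field k]
    {A B : Type u} [Ring A] [Algebra k A] [Ring B] [Algebra k B]
    (𝒜 : ℤ → Submodule k A) (ℬ : ℤ → Submodule k B) [GradedAlgebra 𝒜] [GradedAlgebra ℬ]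
    (hstdA : StdGraded k 𝒜) (hstdB : StdGraded k ℬ)
    (S R : ℕ → Set ℤ) (X : GrMod k A 𝒜) (Y : GrMod k B ℬ)
    (hX : GrMod.SDetermined S X) (hY : GrMod.SDetermined R Y)
    (Q : GrMod k (A ⊗[k] B) (tensorGrading k 𝒜 ℬ))
    (e : Q.carrier ≃ₗ[k] (X.carrier ⊗[k] Y.carrier))
    (heact : ∀ (a : A) (b : B) (x : X.carrier) (y : Y.carrier) (q : Q.carrier),
      e q = x ⊗ₜ[k] y → e ((a ⊗ₜ[k] b) • q) = (a • x) ⊗ₜ[k] (b • y))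
    (hegr : ∀ n : ℤ, (Q.grading n).map (e : Q.carrier →ₗ[k] X.carrier ⊗[k] Y.carrier) =
      Submodule.span k {z | ∃ (i j : ℤ) (x : X.carrier) (y : Y.carrier),
        x ∈ X.grading i ∧ y ∈ Y.grading j ∧ i + j = n ∧ z = x ⊗ₜ[k] y}) :
    GrMod.SDetermined (collTensor S R) Q := by
  let f : X.carrier ⊗[k] Y.carrier →ₗ[k] Q.carrier := e.symm.toLinearMap
  have hf : ∀ (a : A) (b : B) (x : X.carrier) (y : Y.carrier),
      f ((a • x) ⊗ₜ (b • y)) = (a ⊗ₜ[k] b) • f (x ⊗ₜ y) := fun a b x y => by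
    refine e.injective ?_
    exact (e.apply_symm_apply _).trans (heact a b x y _ (e.apply_symm_apply _)).symm
  have hbij : Function.Bijective (GrMod.tensorLift f hf) :=
    e.symm.bijective.comp (GrMod.tensorEquiv X Y).symm.bijective
  refine (hX.tensor hY).of_equiv (LinearEquiv.ofBijective (GrMod.tensorLift f hf) hbij)
    fun n z hz => ?_
  rw [GrMod.tensor_grading] at hz
  obtain ⟨z, hz, rfl⟩ := hz
  have hz' : z ∈ (Q.grading n).map (e : Q.carrier →ₗ[k] X.carrier ⊗[k] Y.carrier) := by
    rw [hegr]
    exact hz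
  obtain ⟨q, hq, rfl⟩ := hz'
  have hq' : GrMod.tensorLift f hf (GrMod.tensorEquiv X Y (e q)) = q := by
    rw [GrMod.tensorLift_tensorEquiv]
    exact e.symm_apply_apply q
  change GrMod.tensorLift f hf (GrMod.tensorEquiv X Y (e q)) ∈ Q.grading n
  rwa [hq']
end

section
/- Let A be a nonnegatively graded k-algebra generated in degrees 0 and 1 with A_0 a finite product of copies of k, and let S = (S_i) be a collection of subsets of ℤ. Then A_0 is an S-determined right A-module if and only if A is an S-determined module over the enveloping algebra A^op⊗A. -/
universe u

variable (k : Type u) [Field k]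

open scoped TensorProduct

section HomogeneousProjection

variable {k : Type*} [Field k] {V : Type*} [AddCommGroup V] [Module k V]
  {ℳ : ℤ → Submodule k V}

/-- The decomposition of a vector into its homogeneous components. -/
noncomputable def homDecompose (h : DirectSum.IsInternal ℳ) : V ≃ₗ[k] DirectSum ℤ fun i => ℳ i :=
  (LinearEquiv.ofBijective (DirectSum.coeLinearMap ℳ) (by exact h)).symm

/-- The projection onto the degree-`n` component of an internal direct sum. -/
noncomputable def homProj (h : DirectSum.IsInternal ℳ) (n : ℤ) : V →ₗ[k] V :=
  (ℳ n).subtype ∘ₗ DirectSum.component k ℤ (fun i => ℳ i) n ∘ₗ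
    (homDecompose h).toLinearMap

lemma homProj_mem (h : DirectSum.IsInternal ℳ) (n : ℤ) (x : V) : homProj h n x ∈ ℳ n :=
  Subtype.property _

lemma homDecompose_of_mem (h : DirectSum.IsInternal ℳ) {n : ℤ} {x : V} (hx : x ∈ ℳ n) :
    homDecompose h x = DirectSum.lof k ℤ (fun i => ℳ i) n ⟨x, hx⟩ := by
  rw [homDecompose, LinearEquiv.symm_apply_eq]
  exact (DirectSum.coeLinearMap_lof ℳ n ⟨x, hx⟩).symm

lemma homProj_of_mem (h : DirectSum.IsInternal ℳ) {n : ℤ} {x : V} (hx : x ∈ ℳ n) :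
    homProj h n x = x := by
  simp [homProj, homDecompose_of_mem h hx, DirectSum.component.lof_self]

lemma homProj_of_mem_ne (h : DirectSum.IsInternal ℳ) {m n : ℤ} {x : V} (hx : x ∈ ℳ m)
    (hmn : m ≠ n) : homProj h n x = 0 := by
  simp [homProj, homDecompose_of_mem h hx, DirectSum.component.of, hmn]

/-- Induction on homogeneous elements. -/
@[elab_as_elim]
lemma isInternal_induction (h : DirectSum.IsInternal ℳ) {p : V → Prop} (x : V)
    (hom : ∀ n, ∀ y ∈ ℳ n, p y) (add : ∀ y z, p y → p z → p (y + z)) : p x := by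
  have hx : x ∈ ⨆ n, ℳ n := by rw [h.submodule_iSup_eq_top]; trivial
  exact Submodule.iSup_induction ℳ (motive := p) hx hom (hom 0 0 (zero_mem _)) add

lemma sum_homProj (h : DirectSum.IsInternal ℳ) (x : V) :
    ∃ s : Finset ℤ, x = ∑ n ∈ s, homProj h n x ∧ ∀ n ∉ s, homProj h n x = 0 := by
  classical
  set y := homDecompose h x with hy
  refine ⟨DFinsupp.support y, ?_, ?_⟩
  · have : x = DirectSum.coeLinearMap ℳ y :=
      ((homDecompose h).symm_apply_apply x).symm
    conv_lhs => rw [this, DirectSum.coeLinearMap_eq_dfinsuppSum]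
    rfl
  · intro n hn
    have : y n = 0 := by simpa using hn
    change ((y n : ℳ n) : V) = 0
    rw [this]; rfl

lemma mem_of_homProj_eq_zero (h : DirectSum.IsInternal ℳ) {n : ℤ} {x : V}
    (hx : ∀ m, m ≠ n → homProj h m x = 0) : x ∈ ℳ n := by
  obtain ⟨s, hs, -⟩ := sum_homProj h x
  rw [hs]
  refine Submodule.sum_mem _ fun m _ => ?_
  by_cases hm : m = n
  · exact hm ▸ homProj_mem h m x
  · rw [hx m hm]; exact zero_mem _

/-- A spanning family of submodules is an internal direct sum as soon as an element of one of
them which vanishes under every additive map killing the others is zero. -/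
lemma isInternal_of_detect (htop : ∀ x : V, x ∈ ⨆ n, ℳ n)
    (h : ∀ n, ∀ x ∈ ℳ n, (∀ p : V → Prop, (∀ m, m ≠ n → ∀ y ∈ ℳ m, p y) → p 0 →
      (∀ y z, p y → p z → p (y + z)) → p x) → x = 0) : DirectSum.IsInternal ℳ := by
  rw [DirectSum.isInternal_submodule_iff_iSupIndep_and_iSup_eq_top]
  refine ⟨fun n => ?_, eq_top_iff.2 fun x _ => htop x⟩
  rw [Submodule.disjoint_def]
  intro x hx hx'
  refine h n x hx fun p hp h0 hadd => ?_
  rw [iSup_subtype'] at hx'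
  exact Submodule.iSup_induction _ (motive := p) hx' (fun i y hy => hp i.1 i.2 y hy) h0 hadd

end HomogeneousProjection

namespace GrMod

section Basic

variable {k : Type u} [Field k] {R : Type u} [Ring R] [Algebra k R] {𝒜 : ℤ → Submodule k R}

instance (M : GrMod k R 𝒜) : IsScalarTower k R M.carrier where
  smul_assoc c r x := by
    rw [Algebra.smul_def, mul_smul, M.central]

/-- The projection of a graded module onto its degree-`n` component. -/
noncomputable abbrev proj (M : GrMod k R 𝒜) (n : ℤ) : M.carrier →ₗ[k] M.carrier :=
  homProj M.isInternal n

lemma proj_smul (M : GrMod k R 𝒜) {i : ℤ} {r : R} (hr : r ∈ 𝒜 i) (n : ℤ) (x : M.carrier) :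
    M.proj n (r • x) = r • M.proj (n - i) x := by
  refine isInternal_induction M.isInternal x (fun j y hy => ?_) (fun y z hy hz => ?_)
  · by_cases h : i + j = n
    · subst h
      rw [homProj_of_mem _ (M.smul_mem hr hy), add_sub_cancel_left, homProj_of_mem _ hy]
    · rw [homProj_of_mem_ne _ (M.smul_mem hr hy) h, homProj_of_mem_ne _ hy (by omega), smul_zero]
  · rw [smul_add, map_add, map_add, smul_add, hy, hz]

lemma Hom.proj_apply {M N : GrMod k R 𝒜} (f : Hom M N) (n : ℤ) (x : M.carrier) :
    f.toLin (M.proj n x) = N.proj n (f.toLin x) := by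
  refine isInternal_induction M.isInternal x (fun j y hy => ?_) (fun y z hy hz => ?_)
  · by_cases h : j = n
    · subst h
      rw [homProj_of_mem _ hy, homProj_of_mem _ (f.map_grading _ _ hy)]
    · rw [homProj_of_mem_ne _ hy h, homProj_of_mem_ne _ (f.map_grading _ _ hy) h, map_zero]
  · simp only [map_add, hy, hz]

/-- Composition of morphisms of graded modules. -/
def Hom.comp {L M N : GrMod k R 𝒜} (g : Hom M N) (f : Hom L M) : Hom L N where
  toLin := g.toLin ∘ₗ f.toLin
  map_grading i x hx := g.map_grading i _ (f.map_grading i x hx)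

/-- The identity of a graded module. -/
def Hom.id (M : GrMod k R 𝒜) : Hom M M where
  toLin := LinearMap.id
  map_grading _ _ hx := hx

/-- The difference of two morphisms of graded modules. -/
def Hom.sub {M N : GrMod k R 𝒜} (f g : Hom M N) : Hom M N where
  toLin := f.toLin - g.toLin
  map_grading i x hx := Submodule.sub_mem _ (f.map_grading i x hx) (g.map_grading i x hx)

/-- A submodule stable under the homogeneous projections, as a graded module. -/
noncomputable def ofSubmodule (M : GrMod k R 𝒜) (U : Submodule R M.carrier)
    (hU : ∀ n, ∀ x ∈ U, M.proj n x ∈ U) : GrMod k R 𝒜 where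
  carrier := U
  central c x := Subtype.ext (M.central c x)
  grading n := (M.grading n).comap (U.subtype.restrictScalars k)
  isInternal := by
    refine isInternal_of_detect (fun x => ?_) (fun n x hx h => ?_)
    · obtain ⟨s, hs, -⟩ := sum_homProj M.isInternal (x : M.carrier)
      have : x = ∑ n ∈ s, (⟨M.proj n x, hU n _ x.2⟩ : U) := by
        apply Subtype.ext
        rw [AddSubmonoidClass.coe_finsetSum]
        exact hs
      rw [this]
      exact Submodule.sum_mem _ fun n _ =>
        Submodule.mem_iSup_of_mem n (homProj_mem M.isInternal n x)
    · apply Subtype.ext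
      have hx' : (x : M.carrier) ∈ M.grading n := hx
      rw [← homProj_of_mem M.isInternal hx']
      refine h (fun y => M.proj n (y : M.carrier) = 0) (fun m hm y hy => ?_) (by simp)
        (fun y z hy hz => by simp only [Submodule.coe_add, map_add, hy, hz, add_zero])
      exact homProj_of_mem_ne M.isInternal (x := (y : M.carrier)) hy hm
  smul_mem ha hx := M.smul_mem ha hx

/-- The inclusion of a graded submodule. -/
noncomputable def ofSubmoduleIncl (M : GrMod k R 𝒜) (U : Submodule R M.carrier)
    (hU : ∀ n, ∀ x ∈ U, M.proj n x ∈ U) : Hom (M.ofSubmodule U hU) M where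
  toLin := U.subtype
  map_grading _ _ hx := hx

/-- The kernel of a morphism of graded modules. -/
noncomputable def Hom.ker {M N : GrMod k R 𝒜} (f : Hom M N) : GrMod k R 𝒜 :=
  M.ofSubmodule (LinearMap.ker f.toLin) fun n x hx => by
    rw [LinearMap.mem_ker] at hx ⊢
    rw [f.proj_apply, hx, map_zero]

/-- The inclusion of the kernel. -/
noncomputable def Hom.kerIncl {M N : GrMod k R 𝒜} (f : Hom M N) : Hom f.ker M :=
  M.ofSubmoduleIncl (LinearMap.ker f.toLin) _

lemma Hom.kerIncl_injective {M N : GrMod k R 𝒜} (f : Hom M N) :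
    Function.Injective f.kerIncl.toLin := Subtype.val_injective

lemma Hom.exact_kerIncl {M N : GrMod k R 𝒜} (f : Hom M N) :
    Function.Exact f.kerIncl.toLin f.toLin := fun y =>
  ⟨fun hy => ⟨⟨y, hy⟩, rfl⟩, by rintro ⟨z, rfl⟩; exact z.2⟩

/-- A morphism landing in the image of an injective morphism factors through it. -/
lemma Hom.exists_lift {K P Q : GrMod k R 𝒜} (i : Hom K P) (hi : Function.Injective i.toLin)
    (g : Hom Q P) (hg : ∀ x, g.toLin x ∈ Set.range i.toLin) :
    ∃ h : Hom Q K, ∀ x, i.toLin (h.toLin x) = g.toLin x := by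
  let e := LinearEquiv.ofInjective i.toLin hi
  let l : Q.carrier →ₗ[R] K.carrier :=
    e.symm.toLinearMap ∘ₗ g.toLin.codRestrict (LinearMap.range i.toLin) hg
  have hl : ∀ x, i.toLin (l x) = g.toLin x := fun x =>
    congrArg Subtype.val (e.apply_symm_apply ⟨g.toLin x, hg x⟩)
  refine ⟨⟨l, fun n x hx => mem_of_homProj_eq_zero K.isInternal fun m hm => hi ?_⟩, hl⟩
  rw [i.proj_apply, hl, map_zero]
  exact homProj_of_mem_ne _ (g.map_grading _ _ hx) hm.symm

/-- The quotient of a graded module by a submodule stable under the homogeneous projections. -/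
noncomputable def quotient (M : GrMod k R 𝒜) (U : Submodule R M.carrier)
    (hU : ∀ n, ∀ x ∈ U, M.proj n x ∈ U) : GrMod k R 𝒜 where
  carrier := M.carrier ⧸ U
  central c x := by
    induction x using Submodule.Quotient.induction_on with
    | H x => exact congrArg (Submodule.Quotient.mk (p := U)) (M.central c x)
  grading n := (M.grading n).map (U.mkQ.restrictScalars k)
  isInternal := by
    refine isInternal_of_detect (fun x => ?_) (fun n x hx h => ?_)
    · obtain ⟨x, rfl⟩ := U.mkQ_surjective x
      refine isInternal_induction M.isInternal x (fun n y hy => ?_) (fun y z hy hz => ?_)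
      · exact Submodule.mem_iSup_of_mem n ⟨y, hy, rfl⟩
      · rw [map_add]; exact add_mem hy hz
    · obtain ⟨x, hx, rfl⟩ := hx
      have key := h (fun y => ∀ z, U.mkQ z = y → M.proj n z ∈ U) ?_ ?_ ?_ x rfl
      · rw [homProj_of_mem _ hx] at key
        exact (Submodule.Quotient.mk_eq_zero U).2 key
      · rintro m hm _ ⟨y, hy, rfl⟩ z hz
        have h1 : z - y ∈ U := (Submodule.Quotient.eq U).1 hz
        have h2 := hU n _ h1
        rwa [map_sub, homProj_of_mem_ne M.isInternal hy hm, sub_zero] at h2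
      · exact fun z hz => hU n z ((Submodule.Quotient.mk_eq_zero U).1 hz)
      · intro y z hy hz w hw
        obtain ⟨y, rfl⟩ := U.mkQ_surjective y
        have h1 := hy y rfl
        have h2 := hz (w - y) (by rw [map_sub, hw, add_sub_cancel_left])
        have := add_mem h1 h2
        rwa [← map_add, add_sub_cancel] at this
  smul_mem := by
    rintro i j a _ ha ⟨y, hy, rfl⟩
    exact ⟨a • y, M.smul_mem ha hy, rfl⟩

/-- The projection onto a graded quotient. -/
noncomputable def quotientMk (M : GrMod k R 𝒜) (U : Submodule R M.carrier)
    (hU : ∀ n, ∀ x ∈ U, M.proj n x ∈ U) : Hom M (M.quotient U hU) where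
  toLin := U.mkQ
  map_grading _ x hx := ⟨x, hx, rfl⟩

/-- Lifting against surjections, out of a projective graded module. -/
lemma Hom.exists_projective_lift (hR : ∀ r : R, r ∈ ⨆ n, 𝒜 n) {P X Y : GrMod k R 𝒜}
    [Module.Projective R P.carrier] (g : Hom X Y) (hg : Function.Surjective g.toLin)
    (f : Hom P Y) : ∃ h : Hom P X, ∀ x, g.toLin (h.toLin x) = f.toLin x := by
  classical
  obtain ⟨l, hl⟩ := Module.projective_lifting_property g.toLin f.toLin hg
  let H : P.carrier →ₗ[k] X.carrier :=
    DirectSum.toModule k ℤ X.carrier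
      (fun n => X.proj n ∘ₗ l.restrictScalars k ∘ₗ (P.grading n).subtype) ∘ₗ
      (homDecompose P.isInternal).toLinearMap
  have hH : ∀ n x, x ∈ P.grading n → H x = X.proj n (l x) := by
    intro n x hx
    simp [H, homDecompose_of_mem P.isInternal hx]
  have hsmul : ∀ (r : R) (x : P.carrier), H (r • x) = r • H x := by
    intro r x
    refine isInternal_induction P.isInternal x (fun j y hy => ?_) (fun y z hy hz => ?_)
    · refine Submodule.iSup_induction 𝒜 (motive := fun r => H (r • y) = r • H y) (hR r)
        (fun i r hr => ?_) (by simp) (fun r s hr hs => by simp only [add_smul, map_add, hr, hs])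
      rw [hH _ _ (P.smul_mem hr hy), hH _ _ hy, map_smul, X.proj_smul hr, add_sub_cancel_left]
    · rw [smul_add, map_add, map_add, smul_add, hy, hz]
  refine ⟨⟨⟨H.toAddHom, hsmul⟩, fun n x hx => ?_⟩, fun x => ?_⟩
  · change H x ∈ _
    rw [hH n x hx]
    exact homProj_mem _ _ _
  · change g.toLin (H x) = _
    refine isInternal_induction P.isInternal x (fun j y hy => ?_) (fun y z hy hz => ?_)
    · rw [hH j y hy, g.proj_apply]
      have : g.toLin (l y) = f.toLin y := LinearMap.congr_fun hl y
      rw [this, homProj_of_mem _ (f.map_grading _ _ hy)]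
    · rw [map_add, map_add, map_add, hy, hz]

end Basic

end GrMod

namespace GrMod

section Resolutions

variable {k : Type u} [Field k] {R : Type u} [Ring R] [Algebra k R] {𝒜 : ℤ → Submodule k R}

lemma GeneratedIn.of_surjective {P Q : GrMod k R 𝒜} {T : Set ℤ} (h : P.GeneratedIn T)
    (g : Hom P Q) (hg : Function.Surjective g.toLin) : Q.GeneratedIn T := by
  rw [GeneratedIn, eq_top_iff, ← LinearMap.range_eq_top.2 hg, LinearMap.range_eq_map, ← h,
    Submodule.map_span, Submodule.span_le]
  rintro _ ⟨x, hx, rfl⟩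
  obtain ⟨j, hj, hx⟩ := Set.mem_iUnion₂.1 hx
  exact Submodule.subset_span (Set.mem_iUnion₂.2 ⟨j, hj, g.map_grading j x hx⟩)

/-- An `S`-determined module admits a first step of a resolution with `S`-determined kernel. -/
lemma SDetermined.exists_step {S : ℕ → Set ℤ} {X : GrMod k R 𝒜} (h : SDetermined S X) :
    ∃ (P : GrMod k R 𝒜) (f : Hom P X), Module.Projective R P.carrier ∧ GeneratedIn P (S 0) ∧
      Function.Surjective f.toLin ∧ SDetermined (fun n => S (n + 1)) f.ker := by
  obtain ⟨Q, hQ⟩ := h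
  refine ⟨Q.P 0, Q.aug, Q.projective 0, hQ 0, Q.surj, ?_⟩
  obtain ⟨a, ha⟩ := Q.aug.kerIncl.exists_lift Q.aug.kerIncl_injective (Q.d 0)
    (fun x => (Q.aug.exact_kerIncl _).1 ((Q.exact0 _).2 ⟨x, rfl⟩))
  have hinj := Q.aug.kerIncl_injective
  refine ⟨⟨fun n => Q.P (n + 1), fun n => Q.d (n + 1), a, fun n => Q.projective (n + 1),
    fun y => ?_, fun x => ?_, fun n => Q.exactS (n + 1)⟩, fun n => hQ (n + 1)⟩
  · obtain ⟨x, hx⟩ := (Q.exact0 _).1 ((Q.aug.exact_kerIncl _).2 ⟨y, rfl⟩)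
    exact ⟨x, hinj ((ha x).trans hx)⟩
  · rw [← Q.exactS 0 x, ← ha, map_eq_zero_iff _ hinj]

/-- A property of graded modules which is inherited by the kernel of a suitable projective
presentation implies being `S`-determined. -/
lemma sDetermined_of_step (Q : (ℕ → Set ℤ) → GrMod k R 𝒜 → Prop)
    (h : ∀ S X, Q S X → ∃ (P K : GrMod k R 𝒜) (f : Hom P X) (i : Hom K P),
      Module.Projective R P.carrier ∧ GeneratedIn P (S 0) ∧ Function.Surjective f.toLin ∧
      Function.Injective i.toLin ∧ Function.Exact i.toLin f.toLin ∧ Q (fun n => S (n + 1)) K)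
    {S : ℕ → Set ℤ} {X : GrMod k R 𝒜} (hX : Q S X) : SDetermined S X := by
  choose P K f i hP hgen hf hi hex hQ using h
  let next (s : {s : (ℕ → Set ℤ) × GrMod k R 𝒜 // Q s.1 s.2}) :
      {s : (ℕ → Set ℤ) × GrMod k R 𝒜 // Q s.1 s.2} :=
    ⟨(fun n => s.1.1 (n + 1), K _ _ s.2), hQ _ _ s.2⟩
  let st (n : ℕ) : {s : (ℕ → Set ℤ) × GrMod k R 𝒜 // Q s.1 s.2} :=
    n.rec ⟨(S, X), hX⟩ fun _ s => next s
  have hS : ∀ n, (st n).1.1 = fun m => S (m + n) := by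
    intro n
    induction n with
    | zero => rfl
    | succ n ih =>
      change (fun m => (st n).1.1 (m + 1)) = _
      rw [ih]
      funext m
      change S (m + 1 + n) = S (m + (n + 1))
      rw [add_assoc, add_comm 1 n]
  have hexact : ∀ (s : {s : (ℕ → Set ℤ) × GrMod k R 𝒜 // Q s.1 s.2}) (x : _),
      (f _ _ s.2).toLin x = 0 ↔
        x ∈ Set.range ((i _ _ s.2).comp (f _ _ (next s).2)).toLin := by
    intro s x
    rw [hex _ _ s.2 x]
    constructor
    · rintro ⟨y, rfl⟩
      obtain ⟨z, rfl⟩ := hf _ _ (next s).2 y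
      exact ⟨z, rfl⟩
    · rintro ⟨z, rfl⟩
      exact ⟨_, rfl⟩
  refine ⟨⟨fun n => P _ _ (st n).2, fun n => (i _ _ (st n).2).comp (f _ _ (st (n + 1)).2),
    f _ _ (st 0).2, fun n => hP _ _ _, hf _ _ _, hexact (st 0), fun n x => ?_⟩, fun n => ?_⟩
  · rw [← hexact (st (n + 1)) x]
    exact map_eq_zero_iff (i _ _ (st n).2).toLin (hi _ _ (st n).2)
  · have := hgen _ _ (st n).2
    rwa [show (st n).1.1 0 = S n by rw [hS]; exact congrArg S (zero_add n)] at this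

lemma sDetermined_of_exact {S : ℕ → Set ℤ} {X P K : GrMod k R 𝒜} (f : Hom P X) (i : Hom K P)
    [Module.Projective R P.carrier] (hgen : GeneratedIn P (S 0))
    (hf : Function.Surjective f.toLin) (hi : Function.Injective i.toLin)
    (hex : Function.Exact i.toLin f.toLin) (hK : SDetermined (fun n => S (n + 1)) K) :
    SDetermined S X := by
  refine sDetermined_of_step (fun S X => ∃ (P K : GrMod k R 𝒜) (f : Hom P X) (i : Hom K P),
      Module.Projective R P.carrier ∧ GeneratedIn P (S 0) ∧ Function.Surjective f.toLin ∧
      Function.Injective i.toLin ∧ Function.Exact i.toLin f.toLin ∧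
      SDetermined (fun n => S (n + 1)) K) ?_ ⟨P, K, f, i, inferInstance, hgen, hf, hi, hex, hK⟩
  rintro S X ⟨P, K, f, i, h1, h2, h3, h4, h5, h6⟩
  refine ⟨P, K, f, i, h1, h2, h3, h4, h5, ?_⟩
  obtain ⟨P', f', h1', h2', h3', h4'⟩ := h6.exists_step
  exact ⟨P', f'.ker, f', f'.kerIncl, h1', h2', h3', f'.kerIncl_injective, f'.exact_kerIncl, h4'⟩

lemma SDetermined.of_bijective {S : ℕ → Set ℤ} {X Y : GrMod k R 𝒜} (h : SDetermined S X)
    (g : Hom X Y) (hg : Function.Bijective g.toLin) : SDetermined S Y := by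
  obtain ⟨P, f, h1, h2, h3, h4⟩ := h.exists_step
  refine sDetermined_of_exact (g.comp f) f.kerIncl h2 (hg.2.comp h3) f.kerIncl_injective
    (fun x => ?_) h4
  rw [← f.exact_kerIncl x]
  exact map_eq_zero_iff g.toLin hg.1

/-- The part `R_{>0} M` of a graded module `M`. -/
def posPart (M : GrMod k R 𝒜) : Submodule k M.carrier :=
  Submodule.span k {z | ∃ i : ℤ, 0 < i ∧ ∃ r ∈ 𝒜 i, ∃ x : M.carrier, z = r • x}

lemma smul_mem_posPart (M : GrMod k R 𝒜) {i : ℤ} (hi : 0 < i) {r : R} (hr : r ∈ 𝒜 i)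
    (x : M.carrier) : r • x ∈ M.posPart :=
  Submodule.subset_span ⟨i, hi, r, hr, x, rfl⟩

lemma GeneratedIn.mem_posPart (htop : ∀ r : R, r ∈ ⨆ n, 𝒜 n) (hneg : ∀ i < 0, 𝒜 i = ⊥)
    {M : GrMod k R 𝒜} {T : Set ℤ} (hM : M.GeneratedIn T) {d : ℤ} (hd : d ∉ T) {x : M.carrier}
    (hx : x ∈ M.grading d) : x ∈ M.posPart := by
  suffices h : ∀ r : R, M.proj d (r • x) ∈ M.posPart by
    simpa [homProj_of_mem _ hx] using h 1
  have hx' : x ∈ Submodule.span R (⋃ j ∈ T, (M.grading j : Set M.carrier)) := by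
    rw [hM]; trivial
  clear hx
  induction hx' using Submodule.span_induction with
  | mem x hx =>
    obtain ⟨j, hj, hx⟩ := Set.mem_iUnion₂.1 hx
    intro r
    refine Submodule.iSup_induction 𝒜 (motive := fun r => M.proj d (r • x) ∈ M.posPart) (htop r)
      (fun i r hr => ?_) (by simp)
      (fun r s hr hs => by simp only [add_smul, map_add]; exact add_mem hr hs)
    rw [M.proj_smul hr]
    by_cases h : j = d - i
    · rcases lt_trichotomy i 0 with hi | hi | hi
      · rw [hneg i hi, Submodule.mem_bot] at hr
        simp [hr]
      · exact absurd (by rwa [h, hi, sub_zero] at hj) hd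
      · exact M.smul_mem_posPart hi hr _
    · rw [homProj_of_mem_ne _ hx h, smul_zero]
      exact zero_mem _
  | zero => simp
  | add x y _ _ hx hy =>
    intro r
    rw [smul_add, map_add]
    exact add_mem (hx r) (hy r)
  | smul a x _ hx =>
    intro r
    rw [← mul_smul]
    exact hx _

/-- Nakayama's lemma for graded modules bounded below. -/
lemma Hom.surjective_of_posPart {P Q : GrMod k R 𝒜} (f : Hom Q P) {c : ℤ}
    (hc : ∀ n < c, P.grading n = ⊥) (h : ∀ x, ∃ q, x - f.toLin q ∈ P.posPart) :
    Function.Surjective f.toLin := by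
  have key : ∀ N : ℕ, ∀ n < c + N, ∀ x ∈ P.grading n, x ∈ LinearMap.range f.toLin := by
    intro N
    induction N with
    | zero =>
      intro n hn x hx
      rw [hc n (by simpa using hn), Submodule.mem_bot] at hx
      rw [hx]
      exact zero_mem _
    | succ N ih =>
      intro n hn x hx
      obtain ⟨q, hq⟩ := h x
      have hpos : P.posPart ≤
          ((LinearMap.range f.toLin).restrictScalars k).comap (P.proj n) := by
        rw [posPart, Submodule.span_le]
        rintro _ ⟨i, hi, r, hr, z, rfl⟩
        change P.proj n (r • z) ∈ LinearMap.range f.toLin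
        rw [P.proj_smul hr]
        refine Submodule.smul_mem _ _ (ih (n - i) ?_ _ (homProj_mem _ _ _))
        push_cast at hn
        omega
      have h1 : P.proj n (x - f.toLin q) ∈ LinearMap.range f.toLin := hpos hq
      rw [map_sub, homProj_of_mem _ hx, ← f.proj_apply] at h1
      simpa using add_mem h1 (LinearMap.mem_range_self f.toLin (Q.proj n q))
  intro x
  refine isInternal_induction P.isInternal x (fun n y hy => ?_) (fun y z hy hz => ?_)
  · exact key (n - c + 1).toNat n (by omega) y hy
  · obtain ⟨a, rfl⟩ := hy
    obtain ⟨b, rfl⟩ := hz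
    exact ⟨a + b, map_add _ _ _⟩

/-- The kernel of a minimal projective presentation of an `S`-determined module is determined
by the shifted collection. -/
lemma SDetermined.of_minimal (htop : ∀ r : R, r ∈ ⨆ n, 𝒜 n) {S : ℕ → Set ℤ}
    {X P K : GrMod k R 𝒜} (hX : SDetermined S X) (f : Hom P X) (i : Hom K P)
    [Module.Projective R P.carrier] (hf : Function.Surjective f.toLin)
    (hi : Function.Injective i.toLin) (hex : Function.Exact i.toLin f.toLin)
    (hmin : ∀ x, f.toLin x = 0 → x ∈ P.posPart) {c : ℤ} (hc : ∀ n < c, P.grading n = ⊥) :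
    SDetermined (fun n => S (n + 1)) K := by
  obtain ⟨Q₀, a, hQ₀, -, ha, hZ⟩ := hX.exists_step
  obtain ⟨Q₁, b, hQ₁, hgen, hb, hZ'⟩ := hZ.exists_step
  obtain ⟨φ, hφ⟩ := f.exists_projective_lift htop hf a
  have hφsurj : Function.Surjective φ.toLin := φ.surjective_of_posPart hc fun x => by
    obtain ⟨q, hq⟩ := ha (f.toLin x)
    exact ⟨q, hmin _ (by rw [map_sub, hφ, hq, sub_self])⟩
  obtain ⟨s, hs⟩ := φ.exists_projective_lift htop hφsurj (Hom.id P)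
  replace hs : ∀ x, φ.toLin (s.toLin x) = x := hs
  let d : Hom Q₁ Q₀ := a.kerIncl.comp b
  have had : ∀ x, a.toLin (d.toLin x) = 0 := fun x => (a.exact_kerIncl _).2 ⟨_, rfl⟩
  have hd : ∀ y, a.toLin y = 0 → ∃ x, d.toLin x = y := fun y hy => by
    obtain ⟨z, rfl⟩ := (a.exact_kerIncl _).1 hy
    obtain ⟨x, rfl⟩ := hb z
    exact ⟨x, rfl⟩
  let ρ : Hom Q₀ Q₀ := (Hom.id Q₀).sub (s.comp φ)
  have hρ : ∀ x, ρ.toLin x = x - s.toLin (φ.toLin x) := fun _ => rfl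
  have hφρ : ∀ x, φ.toLin (ρ.toLin x) = 0 := fun x => by rw [hρ, map_sub, hs, sub_self]
  obtain ⟨r, hr⟩ := φ.kerIncl.exists_lift φ.kerIncl_injective ρ
    (fun x => (φ.exact_kerIncl _).1 (hφρ x))
  have hφL : ∀ y, φ.toLin (φ.kerIncl.toLin y) = 0 := fun y => (φ.exact_kerIncl _).2 ⟨y, rfl⟩
  have hrL : ∀ y, r.toLin (φ.kerIncl.toLin y) = y := fun y => by
    apply φ.kerIncl_injective
    rw [hr, hρ, hφL, map_zero, sub_zero]
  have : Module.Projective R φ.ker.carrier :=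
    Module.Projective.of_split φ.kerIncl.toLin r.toLin (LinearMap.ext hrL)
  let τ : Hom Q₁ φ.ker := r.comp d
  have hτ : ∀ x, φ.kerIncl.toLin (τ.toLin x) = ρ.toLin (d.toLin x) := fun x => hr _
  have hτsurj : Function.Surjective τ.toLin := fun y => by
    obtain ⟨x, hx⟩ := hd (φ.kerIncl.toLin y) (by rw [← hφ, hφL, map_zero])
    refine ⟨x, ?_⟩
    change r.toLin (d.toLin x) = y
    rw [hx, hrL]
  obtain ⟨σ, hσ⟩ := τ.exists_projective_lift htop hτsurj (Hom.id φ.ker)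
  replace hσ : ∀ x, τ.toLin (σ.toLin x) = x := hσ
  have hτQ : ∀ y, τ.toLin (τ.kerIncl.toLin y) = 0 := fun y => (τ.exact_kerIncl _).2 ⟨y, rfl⟩
  obtain ⟨t, ht⟩ := τ.kerIncl.exists_lift τ.kerIncl_injective ((Hom.id Q₁).sub (σ.comp τ))
    (fun x => (τ.exact_kerIncl _).1 (by
      change τ.toLin (x - σ.toLin (τ.toLin x)) = 0
      rw [map_sub, hσ, sub_self]))
  replace ht : ∀ x, τ.kerIncl.toLin (t.toLin x) = x - σ.toLin (τ.toLin x) := ht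
  have htQ : ∀ y, t.toLin (τ.kerIncl.toLin y) = y := fun y => by
    apply τ.kerIncl_injective
    rw [ht, hτQ, map_zero, sub_zero]
  have : Module.Projective R τ.ker.carrier :=
    Module.Projective.of_split τ.kerIncl.toLin t.toLin (LinearMap.ext htQ)
  obtain ⟨g, hg⟩ := i.exists_lift hi ((φ.comp d).comp τ.kerIncl)
    (fun x => (hex _).1 (by
      change f.toLin (φ.toLin (d.toLin _)) = 0
      rw [hφ, had]))
  replace hg : ∀ x, i.toLin (g.toLin x) = φ.toLin (d.toLin (τ.kerIncl.toLin x)) := hg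
  have hdec : ∀ x, d.toLin (τ.kerIncl.toLin x) = s.toLin (i.toLin (g.toLin x)) := fun x => by
    have := hτ (τ.kerIncl.toLin x)
    rw [hτQ, map_zero, hρ, ← hg] at this
    exact (sub_eq_zero.1 this.symm)
  have hbd : ∀ x, b.toLin x = 0 ↔ d.toLin x = 0 := fun x =>
    (map_eq_zero_iff a.kerIncl.toLin a.kerIncl_injective).symm
  have hdb : ∀ y, d.toLin (b.kerIncl.toLin y) = 0 := fun y =>
    (hbd _).1 ((b.exact_kerIncl _).2 ⟨y, rfl⟩)
  obtain ⟨j, hj⟩ := τ.kerIncl.exists_lift τ.kerIncl_injective b.kerIncl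
    (fun x => (τ.exact_kerIncl _).1 (by
      change r.toLin (d.toLin _) = 0
      rw [hdb, map_zero]))
  refine sDetermined_of_exact g j (hgen.of_surjective t fun y => ⟨_, htQ y⟩) (fun y => ?_)
    (fun x y hxy => ?_) (fun x => ⟨fun hx => ?_, ?_⟩) hZ'
  · obtain ⟨x, hx⟩ := hd (s.toLin (i.toLin y))
      (by rw [← hφ, hs]; exact (hex _).2 ⟨y, rfl⟩)
    have hx0 : τ.toLin x = 0 := by
      apply φ.kerIncl_injective
      rw [hτ, hx, hρ, hs, sub_self, map_zero]
    obtain ⟨z, rfl⟩ := (τ.exact_kerIncl x).1 hx0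
    refine ⟨z, hi ?_⟩
    rw [hg, hx, hs]
  · apply b.kerIncl_injective
    rw [← hj, ← hj, hxy]
  · have h0 : b.toLin (τ.kerIncl.toLin x) = 0 := by
      rw [hbd, hdec, hx, map_zero, map_zero]
    obtain ⟨y, hy⟩ := (b.exact_kerIncl _).1 h0
    exact ⟨y, τ.kerIncl_injective (by rw [hj, hy])⟩
  · rintro ⟨y, rfl⟩
    apply hi
    rw [hg, hj, hdb, map_zero, map_zero]

end Resolutions

end GrMod

namespace GrMod

section ProjectiveCover

variable {k : Type u} [Field k] {R : Type u} [Ring R] [Algebra k R] {𝒜 : ℤ → Submodule k R}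

lemma smul_mem_posPart_of_homProj_zero (hint : DirectSum.IsInternal 𝒜)
    (hneg : ∀ i < 0, 𝒜 i = ⊥) (M : GrMod k R 𝒜) {r : R} (hr : homProj hint 0 r = 0)
    (x : M.carrier) : r • x ∈ M.posPart := by
  obtain ⟨s, hs, -⟩ := sum_homProj hint r
  rw [hs, Finset.sum_smul]
  refine Submodule.sum_mem _ fun n _ => ?_
  have hn := homProj_mem hint n r
  rcases lt_trichotomy n 0 with h | h | h
  · rw [hneg n h, Submodule.mem_bot] at hn
    rw [hn, zero_smul]
    exact zero_mem _
  · rw [h, hr, zero_smul]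
    exact zero_mem _
  · exact M.smul_mem_posPart h hn x

lemma homProj_mul (hint : DirectSum.IsInternal 𝒜)
    (hmul : ∀ {i j : ℤ} {a b : R}, a ∈ 𝒜 i → b ∈ 𝒜 j → a * b ∈ 𝒜 (i + j))
    {ε : R} (hε : ε ∈ 𝒜 0) (n : ℤ) (r : R) :
    homProj hint n (r * ε) = homProj hint n r * ε := by
  refine isInternal_induction hint r (fun j y hy => ?_) (fun y z hy hz => ?_)
  · have hyε : y * ε ∈ 𝒜 j := by simpa using hmul hy hε
    by_cases h : j = n
    · subst h
      rw [homProj_of_mem _ hyε, homProj_of_mem _ hy]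
    · rw [homProj_of_mem_ne _ hyε h, homProj_of_mem_ne _ hy h, zero_mul]
  · rw [add_mul, map_add, map_add, add_mul, hy, hz]

/-- The submodule of `⨁ᵢ R` consisting of the elements of `⨁ᵢ R εᵢ`, for idempotents `εᵢ`. -/
def idemSum {ι : Type u} (ε : ι → R) : Submodule R (ι →₀ R) where
  carrier := {g | ∀ i, g i * ε i = g i}
  add_mem' hx hy i := by rw [Finsupp.add_apply, add_mul, hx i, hy i]
  zero_mem' i := by simp
  smul_mem' r x hx i := by rw [Finsupp.smul_apply, smul_eq_mul, mul_assoc, hx i]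

/-- The map `⨁ᵢ R → ⨁ᵢ R εᵢ` given by right multiplication by the idempotents `εᵢ`. -/
noncomputable def idemSumRetract {ι : Type u} (ε : ι → R) :
    (ι →₀ R) →ₗ[R] (ι →₀ R) :=
  Finsupp.linearCombination R fun i => Finsupp.single i (ε i)

lemma idemSumRetract_apply {ι : Type u} (ε : ι → R) (g : ι →₀ R) (i : ι) :
    idemSumRetract ε g i = g i * ε i := by
  classical
  induction g using Finsupp.induction_linear with
  | zero => simp
  | add f g hf hg => rw [map_add, Finsupp.add_apply, hf, hg, Finsupp.add_apply, add_mul]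
  | single j r =>
    rw [idemSumRetract, Finsupp.linearCombination_single]
    by_cases h : j = i
    · subst h; simp
    · simp [h]

lemma idemSum_projective {ι : Type u} (ε : ι → R) (hε : ∀ i, ε i * ε i = ε i) :
    Module.Projective R (idemSum ε) :=
  Module.Projective.of_split (idemSum ε).subtype
    ((idemSumRetract ε).codRestrict (idemSum ε) fun g i => by
      rw [idemSumRetract_apply, mul_assoc, hε])
    (LinearMap.ext fun g => Subtype.ext (Finsupp.ext fun i => by
      exact (idemSumRetract_apply ε g i).trans (g.2 i)))

lemma single_mem_idemSum {ι : Type u} {ε : ι → R} {i : ι} {r : R} (h : r * ε i = r) :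
    Finsupp.single i r ∈ idemSum ε := by
  classical
  intro j
  rw [Finsupp.single_apply]
  split_ifs with hij
  · rw [← hij, h]
  · rw [zero_mul]

lemma idemSum_eq_sum {ι : Type u} {ε : ι → R} (hε : ∀ i, ε i * ε i = ε i) (g : idemSum ε) :
    g = ∑ i ∈ g.1.support,
      g.1 i • (⟨Finsupp.single i (ε i), single_mem_idemSum (hε i)⟩ : idemSum ε) := by
  apply Subtype.ext
  rw [AddSubmonoidClass.coe_finsetSum]
  conv_lhs => rw [← Finsupp.sum_single g.1, Finsupp.sum]
  refine Finset.sum_congr rfl fun i _ => ?_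
  change _ = g.1 i • (Finsupp.single i (ε i) : ι →₀ R)
  rw [Finsupp.smul_single, smul_eq_mul, g.2 i]

/-- The grading of `⨁ᵢ R εᵢ(-dᵢ)`. -/
def idemSumGrading (𝒜 : ℤ → Submodule k R) {ι : Type u} (ε : ι → R) (d : ι → ℤ) (n : ℤ) :
    Submodule k (idemSum ε) where
  carrier := {g | ∀ i, g.1 i ∈ 𝒜 (n - d i)}
  add_mem' hx hy i := add_mem (hx i) (hy i)
  zero_mem' _ := zero_mem _
  smul_mem' c _ hx i := Submodule.smul_mem _ c (hx i)

lemma idemSumGrading_isInternal (hint : DirectSum.IsInternal 𝒜)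
    (hmul : ∀ {i j : ℤ} {a b : R}, a ∈ 𝒜 i → b ∈ 𝒜 j → a * b ∈ 𝒜 (i + j))
    {ι : Type u} (ε : ι → R) (hε₀ : ∀ i, ε i ∈ 𝒜 0) (d : ι → ℤ) :
    DirectSum.IsInternal (idemSumGrading 𝒜 ε d) := by
  classical
  refine isInternal_of_detect (k := k) (V := idemSum ε) (fun g => ?_) (fun n g hg h => ?_)
  · have hsingle : ∀ i r (hr : Finsupp.single i r ∈ idemSum ε),
        (⟨Finsupp.single i r, hr⟩ : idemSum ε) ∈ ⨆ n, idemSumGrading 𝒜 ε d n := by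
      intro i r hr
      have hri : r * ε i = r := by simpa using hr i
      have hcomp : ∀ n, Finsupp.single i (homProj hint n r) ∈ idemSum ε := fun n =>
        single_mem_idemSum (by rw [← homProj_mul hint hmul (hε₀ i), hri])
      obtain ⟨s, hs, -⟩ := sum_homProj hint r
      have : (⟨Finsupp.single i r, hr⟩ : idemSum ε) = ∑ n ∈ s, ⟨_, hcomp n⟩ := by
        apply Subtype.ext
        rw [AddSubmonoidClass.coe_finsetSum]
        change Finsupp.single i r = ∑ n ∈ s, Finsupp.single i (homProj hint n r)
        rw [← Finsupp.single_finsetSum, ← hs]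
      rw [this]
      refine Submodule.sum_mem _ fun n _ => Submodule.mem_iSup_of_mem (n + d i) fun j => ?_
      change Finsupp.single i (homProj hint n r) j ∈ _
      rw [Finsupp.single_apply]
      split_ifs with h
      · rw [← h, add_sub_cancel_right]; exact homProj_mem _ _ _
      · exact zero_mem _
    have hmem : ∀ i, Finsupp.single i (g.1 i) ∈ idemSum ε := fun i =>
      single_mem_idemSum (g.2 i)
    have : g = ∑ i ∈ g.1.support, ⟨_, hmem i⟩ := by
      apply Subtype.ext
      rw [AddSubmonoidClass.coe_finsetSum]
      exact (Finsupp.sum_single g.1).symm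
    rw [this]
    exact Submodule.sum_mem _ fun i _ => hsingle i _ (hmem i)
  · refine Subtype.ext (Finsupp.ext fun i => ?_)
    rw [← homProj_of_mem hint (hg i)]
    refine h (fun y => homProj hint (n - d i) (y.1 i) = 0) (fun m hm y hy => ?_) (by simp)
      (fun y z hy hz => ?_)
    · exact homProj_of_mem_ne hint (hy i) (by omega)
    · change homProj hint (n - d i) (y.1 i + z.1 i) = 0
      rw [map_add, hy, hz, add_zero]

/-- The graded module `⨁ᵢ R εᵢ(-dᵢ)`, for degree-zero idempotents `εᵢ`. -/
noncomputable def idemSumGr (hint : DirectSum.IsInternal 𝒜)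
    (hmul : ∀ {i j : ℤ} {a b : R}, a ∈ 𝒜 i → b ∈ 𝒜 j → a * b ∈ 𝒜 (i + j))
    {ι : Type u} (ε : ι → R) (hε₀ : ∀ i, ε i ∈ 𝒜 0) (d : ι → ℤ) : GrMod k R 𝒜 where
  carrier := idemSum ε
  acg := inferInstance
  modk := inferInstance
  modR := inferInstance
  central c x := algebraMap_smul R c x
  grading := idemSumGrading 𝒜 ε d
  isInternal := idemSumGrading_isInternal hint hmul ε hε₀ d
  smul_mem {i j a x} ha hx l := by
    rw [add_sub_assoc]
    exact hmul ha (hx l)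

/-- Existence of projective covers of graded modules bounded below, over a nonnegatively graded
algebra whose degree-zero part is spanned by idempotents `ε` with `𝒜₀ ε = k ε`. -/
lemma exists_projective_cover (hint : DirectSum.IsInternal 𝒜) (hneg : ∀ i < 0, 𝒜 i = ⊥)
    (hmul : ∀ {i j : ℤ} {a b : R}, a ∈ 𝒜 i → b ∈ 𝒜 j → a * b ∈ 𝒜 (i + j))
    {J : Type*} [Fintype J] (ε : J → R) (hε₀ : ∀ j, ε j ∈ 𝒜 0)
    (hε : ∀ j, ε j * ε j = ε j) (hε1 : ∑ j, ε j = 1)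
    (hεk : ∀ j, ∀ r ∈ 𝒜 0, ∃ c : k, r * ε j = c • ε j)
    (K : GrMod k R 𝒜) {c : ℤ} (hc : ∀ n < c, K.grading n = ⊥) {T : Set ℤ}
    (hT : ∀ n, n ∉ T → ∀ x ∈ K.grading n, x ∈ K.posPart) :
    ∃ (P : GrMod k R 𝒜) (f : Hom P K), Module.Projective R P.carrier ∧ GeneratedIn P T ∧
      Function.Surjective f.toLin ∧ (∀ x, f.toLin x = 0 → x ∈ P.posPart) ∧
      ∀ n < c, P.grading n = ⊥ := by
  classical
  let Ω : Set K.carrier := {x | ∃ n j, x ∈ K.grading n ∧ ε j • x = x}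
  have hΩ : Submodule.span k Ω = ⊤ := by
    rw [eq_top_iff]
    rintro x -
    refine isInternal_induction K.isInternal x (fun n y hy => ?_) (fun y z hy hz => add_mem hy hz)
    rw [← one_smul R y, ← hε1, Finset.sum_smul]
    refine Submodule.sum_mem _ fun j _ => Submodule.subset_span ⟨n, j, ?_, ?_⟩
    · simpa using K.smul_mem (hε₀ j) hy
    · rw [← mul_smul, hε]
  obtain ⟨b, hbΩ, hbspan, hbli⟩ := exists_linearIndependent k (K.posPart.mkQ '' Ω)
  have hb (i : b) : ∃ x, (∃ n j, x ∈ K.grading n ∧ ε j • x = x) ∧ K.posPart.mkQ x = i.1 :=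
    hbΩ i.2
  choose v hv hvb using hb
  choose d j hd hj using hv
  rw [← Submodule.map_span, hΩ, Submodule.map_top, Submodule.range_mkQ] at hbspan
  have hnot : ∀ i : b, v i ∉ K.posPart := fun i hi => hbli.ne_zero i (by
    rw [← hvb]
    exact (Submodule.Quotient.mk_eq_zero _).2 hi)
  have hdT : ∀ i : b, d i ∈ T := fun i => by
    by_contra h
    exact hnot i (hT _ h _ (hd i))
  have hdc : ∀ i : b, c ≤ d i := fun i => by
    by_contra h
    have := hd i
    rw [hc _ (not_le.1 h), Submodule.mem_bot] at this
    exact hnot i (this ▸ zero_mem _)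
  let E (i : b) : R := ε (j i)
  have hE : ∀ i, E i * E i = E i := fun i => hε _
  let P : GrMod k R 𝒜 := idemSumGr hint hmul E (fun i => hε₀ _) d
  let gen (i : b) : P.carrier := ⟨Finsupp.single i (E i), single_mem_idemSum (hE i)⟩
  have hgen : ∀ i, gen i ∈ P.grading (d i) := fun i l => by
    change Finsupp.single i (E i) l ∈ _
    rw [Finsupp.single_apply]
    split_ifs with h
    · rw [← h, sub_self]; exact hε₀ _
    · exact zero_mem _
  have hsum : ∀ g : P.carrier, g = ∑ i ∈ g.1.support, g.1 i • gen i := fun g =>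
    idemSum_eq_sum hE g
  let f : Hom P K :=
    { toLin := Finsupp.linearCombination R v ∘ₗ (idemSum E).subtype
      map_grading := fun n x hx => by
        refine Submodule.sum_mem _ fun i _ => ?_
        have := K.smul_mem (hx i) (hd i)
        rwa [sub_add_cancel] at this }
  have hf : ∀ g : P.carrier, f.toLin g = ∑ i ∈ g.1.support, g.1 i • v i := fun g => rfl
  have hfgen : ∀ i, f.toLin (gen i) = v i := fun i => by
    change Finsupp.linearCombination R v (Finsupp.single i (E i)) = v i
    rw [Finsupp.linearCombination_single]
    exact hj i
  refine ⟨P, f, idemSum_projective E hE, ?_, ?_, fun x hx => ?_, fun n hn => ?_⟩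
  · rw [GeneratedIn, eq_top_iff]
    rintro g -
    rw [hsum g]
    exact Submodule.sum_mem _ fun i _ => Submodule.smul_mem _ _ <|
      Submodule.subset_span (Set.mem_iUnion₂.2 ⟨d i, hdT i, hgen i⟩)
  · refine f.surjective_of_posPart hc fun x => ?_
    have hx : K.posPart.mkQ x ∈ Submodule.span k b := by rw [hbspan]; trivial
    have hle : Submodule.span k b ≤
        ((LinearMap.range f.toLin).restrictScalars k).map K.posPart.mkQ := by
      rw [Submodule.span_le]
      intro y hy
      exact ⟨v ⟨y, hy⟩, ⟨_, hfgen _⟩, hvb _⟩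
    obtain ⟨_, ⟨q, rfl⟩, hq⟩ := hle hx
    exact ⟨q, (Submodule.Quotient.eq _).1 hq.symm⟩
  · have hex : ∀ i, ∃ a : k, homProj hint 0 (x.1 i) = a • E i := fun i => by
      obtain ⟨a, ha⟩ := hεk (j i) _ (homProj_mem hint 0 (x.1 i))
      refine ⟨a, ?_⟩
      rw [← ha, ← homProj_mul hint hmul (hε₀ _)]
      exact congrArg _ (x.2 i).symm
    choose a ha using hex
    have hrem : ∀ i, homProj hint 0 (x.1 i - a i • E i) = 0 := fun i => by
      rw [map_sub, ha, homProj_of_mem hint (Submodule.smul_mem _ _ (hε₀ (j i))), sub_self]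
    have hzero : ∑ i ∈ x.1.support, a i • i.1 = 0 := by
      have h1 : ∑ i ∈ x.1.support, a i • v i ∈ K.posPart := by
        have h2 : ∑ i ∈ x.1.support, (x.1 i - a i • E i) • v i ∈ K.posPart :=
          Submodule.sum_mem _ fun i _ =>
            smul_mem_posPart_of_homProj_zero hint hneg K (hrem i) _
        simp only [sub_smul, Finset.sum_sub_distrib, ← hf, hx, zero_sub, smul_assoc] at h2
        have h3 : ∀ i, E i • v i = v i := hj
        simpa only [h3, neg_mem_iff] using h2
      have h4 : K.posPart.mkQ (∑ i ∈ x.1.support, a i • v i) = 0 :=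
        (Submodule.Quotient.mk_eq_zero _).2 h1
      simpa only [map_sum, map_smul, hvb] using h4
    have ha0 := linearIndependent_iff'.1 hbli x.1.support a hzero
    rw [hsum x]
    refine Submodule.sum_mem _ fun i hi => ?_
    have := hrem i
    rw [ha0 i hi, zero_smul, sub_zero] at this
    exact smul_mem_posPart_of_homProj_zero hint hneg P this _
  · rw [eq_bot_iff]
    intro g hg
    refine (Submodule.mem_bot k).2 (Subtype.ext (Finsupp.ext fun i => ?_))
    have := hg i
    rw [hneg _ (by have := hdc i; omega), Submodule.mem_bot] at this
    exact this

end ProjectiveCover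

end GrMod

section EnvelopingGrading

variable {k : Type u} [Field k] {A B : Type u} [Ring A] [Algebra k A] [Ring B] [Algebra k B]
  {𝒜 : ℤ → Submodule k A} {ℬ : ℤ → Submodule k B}

lemma op_mem_opGrading {n : ℤ} {a : A} (ha : a ∈ 𝒜 n) : MulOpposite.op a ∈ opGrading k 𝒜 n :=
  ⟨a, ha, rfl⟩

lemma unop_mem_of_mem_opGrading {n : ℤ} {b : Aᵐᵒᵖ} (hb : b ∈ opGrading k 𝒜 n) :
    b.unop ∈ 𝒜 n := by
  obtain ⟨a, ha, rfl⟩ := hb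
  exact ha

lemma opGrading_isInternal (h : DirectSum.IsInternal 𝒜) :
    DirectSum.IsInternal (opGrading k 𝒜) := by
  refine isInternal_of_detect (fun x => ?_) (fun n x hx hp => ?_)
  · induction x using MulOpposite.rec' with
    | _ a =>
      refine isInternal_induction h a (fun n y hy => ?_) (fun y z hy hz => ?_)
      · exact Submodule.mem_iSup_of_mem n (op_mem_opGrading hy)
      · exact add_mem hy hz
  · apply MulOpposite.unop_injective
    rw [← homProj_of_mem h (unop_mem_of_mem_opGrading hx)]
    refine hp (fun y => homProj h n y.unop = 0) (fun m hm y hy => ?_) (by simp)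
      (fun y z hy hz => by rw [MulOpposite.unop_add, map_add, hy, hz, add_zero])
    exact homProj_of_mem_ne h (unop_mem_of_mem_opGrading hy) hm

lemma opGrading_eq_bot (h : ∀ i < 0, 𝒜 i = ⊥) : ∀ i < 0, opGrading k 𝒜 i = ⊥ := fun i hi => by
  rw [opGrading, h i hi, Submodule.map_bot]

lemma opGrading_mul_mem
    (h : ∀ {i j : ℤ} {a b : A}, a ∈ 𝒜 i → b ∈ 𝒜 j → a * b ∈ 𝒜 (i + j)) {i j : ℤ} {a b : Aᵐᵒᵖ}
    (ha : a ∈ opGrading k 𝒜 i) (hb : b ∈ opGrading k 𝒜 j) : a * b ∈ opGrading k 𝒜 (i + j) := by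
  obtain ⟨a, ha, rfl⟩ := ha
  obtain ⟨b, hb, rfl⟩ := hb
  exact ⟨b * a, add_comm j i ▸ h hb ha, rfl⟩

lemma tmul_mem_tensorGrading {i j : ℤ} {a : A} {b : B} (ha : a ∈ 𝒜 i) (hb : b ∈ ℬ j) :
    a ⊗ₜ[k] b ∈ tensorGrading k 𝒜 ℬ (i + j) :=
  Submodule.subset_span ⟨i, j, a, b, ha, hb, rfl, rfl⟩

lemma tensorGrading_eq_bot (hA : ∀ i < 0, 𝒜 i = ⊥) (hB : ∀ i < 0, ℬ i = ⊥) :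
    ∀ i < 0, tensorGrading k 𝒜 ℬ i = ⊥ := by
  intro n hn
  rw [tensorGrading, Submodule.span_eq_bot]
  rintro _ ⟨i, j, a, b, ha, hb, hij, rfl⟩
  rcases lt_or_ge i 0 with hi | hi
  · rw [hA i hi, Submodule.mem_bot] at ha
    rw [ha, TensorProduct.zero_tmul]
  · rw [hB j (by omega), Submodule.mem_bot] at hb
    rw [hb, TensorProduct.tmul_zero]

lemma tensorGrading_mul_mem
    (hA : ∀ {i j : ℤ} {a b : A}, a ∈ 𝒜 i → b ∈ 𝒜 j → a * b ∈ 𝒜 (i + j))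
    (hB : ∀ {i j : ℤ} {a b : B}, a ∈ ℬ i → b ∈ ℬ j → a * b ∈ ℬ (i + j))
    {i j : ℤ} {a b : A ⊗[k] B} (ha : a ∈ tensorGrading k 𝒜 ℬ i)
    (hb : b ∈ tensorGrading k 𝒜 ℬ j) : a * b ∈ tensorGrading k 𝒜 ℬ (i + j) := by
  have h := Submodule.mul_mem_mul ha hb
  rw [tensorGrading, tensorGrading, Submodule.span_mul_span] at h
  refine Submodule.span_le.2 ?_ h
  rintro _ ⟨_, ⟨i₁, i₂, a₁, a₂, h₁, h₂, rfl, rfl⟩, _, ⟨j₁, j₂, b₁, b₂, h₃, h₄, rfl, rfl⟩, rfl⟩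
  change a₁ ⊗ₜ[k] a₂ * b₁ ⊗ₜ[k] b₂ ∈ _
  rw [Algebra.TensorProduct.tmul_mul_tmul, add_add_add_comm]
  exact tmul_mem_tensorGrading (hA h₁ h₃) (hB h₂ h₄)

lemma tensorGrading_isInternal (hA : DirectSum.IsInternal 𝒜) (hB : DirectSum.IsInternal ℬ)
    (hA₀ : ∀ i < 0, 𝒜 i = ⊥) (hB₀ : ∀ i < 0, ℬ i = ⊥) :
    DirectSum.IsInternal (tensorGrading k 𝒜 ℬ) := by
  let p (n : ℤ) : A ⊗[k] B →ₗ[k] A ⊗[k] B :=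
    ∑ i ∈ Finset.Icc 0 n, TensorProduct.map (homProj hA i) (homProj hB (n - i))
  have hp : ∀ n i j a b, a ∈ 𝒜 i → b ∈ ℬ j →
      p n (a ⊗ₜ[k] b) = if i + j = n then a ⊗ₜ[k] b else 0 := by
    intro n i j a b ha hb
    simp only [p, LinearMap.sum_apply, TensorProduct.map_tmul]
    rcases lt_or_ge i 0 with hi | hi
    · rw [hA₀ i hi, Submodule.mem_bot] at ha
      simp [ha]
    rcases lt_or_ge j 0 with hj | hj
    · rw [hB₀ j hj, Submodule.mem_bot] at hb
      simp [hb]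
    split_ifs with h
    · rw [Finset.sum_eq_single i]
      · rw [homProj_of_mem _ ha, ← h, add_sub_cancel_left, homProj_of_mem _ hb]
      · intro l _ hl
        rw [homProj_of_mem_ne _ ha hl.symm, TensorProduct.zero_tmul]
      · intro hi'
        exact absurd (Finset.mem_Icc.2 ⟨hi, by omega⟩) hi'
    · refine Finset.sum_eq_zero fun l _ => ?_
      by_cases hl : i = l
      · rw [homProj_of_mem_ne hB hb (by omega), TensorProduct.tmul_zero]
      · rw [homProj_of_mem_ne hA ha hl, TensorProduct.zero_tmul]
  refine isInternal_of_detect (fun x => ?_) (fun n x hx h => ?_)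
  · induction x using TensorProduct.induction_on with
    | zero => exact zero_mem _
    | add x y hx hy => exact add_mem hx hy
    | tmul a b =>
      refine isInternal_induction hA a (fun i a ha => ?_)
        (fun y z hy hz => by rw [TensorProduct.add_tmul]; exact add_mem hy hz)
      refine isInternal_induction hB b (fun j b hb => ?_)
        (fun y z hy hz => by rw [TensorProduct.tmul_add]; exact add_mem hy hz)
      exact Submodule.mem_iSup_of_mem (i + j) (tmul_mem_tensorGrading ha hb)
  · have h1 : p n x = x := by
      have : tensorGrading k 𝒜 ℬ n ≤ LinearMap.eqLocus (p n) LinearMap.id := by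
        rw [tensorGrading, Submodule.span_le]
        rintro _ ⟨i, j, a, b, ha, hb, hij, rfl⟩
        exact (hp n i j a b ha hb).trans (if_pos hij)
      exact this hx
    rw [← h1]
    refine h (fun y => p n y = 0) (fun m hm y hy => ?_) (map_zero _)
      (fun y z hy hz => by rw [map_add, hy, hz, add_zero])
    have : tensorGrading k 𝒜 ℬ m ≤ LinearMap.ker (p n) := by
      rw [tensorGrading, Submodule.span_le]
      rintro _ ⟨i, j, a, b, ha, hb, hij, rfl⟩
      exact (hp n i j a b ha hb).trans (if_neg (by omega))
    exact this hy

lemma exists_mul_tmul_eq_smul (hA₀ : ∀ i < 0, 𝒜 i = ⊥) (hB₀ : ∀ i < 0, ℬ i = ⊥)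
    {ε : A} {η : B} (hε : ∀ a ∈ 𝒜 0, ∃ c : k, a * ε = c • ε)
    (hη : ∀ b ∈ ℬ 0, ∃ c : k, b * η = c • η) {r : A ⊗[k] B}
    (hr : r ∈ tensorGrading k 𝒜 ℬ 0) : ∃ c : k, r * ε ⊗ₜ[k] η = c • ε ⊗ₜ[k] η := by
  induction hr using Submodule.span_induction with
  | zero => exact ⟨0, by simp⟩
  | add x y _ _ hx hy =>
    obtain ⟨c, hc⟩ := hx
    obtain ⟨d, hd⟩ := hy
    exact ⟨c + d, by rw [add_mul, hc, hd, add_smul]⟩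
  | smul d x _ hx =>
    obtain ⟨c, hc⟩ := hx
    exact ⟨d * c, by rw [smul_mul_assoc, hc, mul_smul]⟩
  | mem x hx =>
    obtain ⟨i, j, a, b, ha, hb, hij, rfl⟩ := hx
    rcases lt_trichotomy i 0 with hi | rfl | hi
    · rw [hA₀ i hi, Submodule.mem_bot] at ha
      exact ⟨0, by simp [ha]⟩
    · obtain rfl : j = 0 := by omega
      obtain ⟨c, hc⟩ := hε a ha
      obtain ⟨d, hd⟩ := hη b hb
      exact ⟨c * d, by rw [Algebra.TensorProduct.tmul_mul_tmul, hc, hd,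
        TensorProduct.smul_tmul_smul]⟩
    · rw [hB₀ j (by omega), Submodule.mem_bot] at hb
      exact ⟨0, by simp [hb]⟩

/-- Products of idempotents form a complete family of idempotents of the tensor product. -/
lemma exists_tensor_idempotents (hA₀ : ∀ i < 0, 𝒜 i = ⊥) (hB₀ : ∀ i < 0, ℬ i = ⊥)
    {I J : Type*} [Fintype I] [Fintype J]
    (ε : I → A) (hε₀ : ∀ i, ε i ∈ 𝒜 0) (hε : ∀ i, ε i * ε i = ε i) (hε1 : ∑ i, ε i = 1)
    (hεk : ∀ i, ∀ a ∈ 𝒜 0, ∃ c : k, a * ε i = c • ε i)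
    (η : J → B) (hη₀ : ∀ j, η j ∈ ℬ 0) (hη : ∀ j, η j * η j = η j) (hη1 : ∑ j, η j = 1)
    (hηk : ∀ j, ∀ b ∈ ℬ 0, ∃ c : k, b * η j = c • η j) :
    ∃ κ : I × J → A ⊗[k] B, (∀ p, κ p ∈ tensorGrading k 𝒜 ℬ 0) ∧ (∀ p, κ p * κ p = κ p) ∧
      ∑ p, κ p = 1 ∧ ∀ p, ∀ r ∈ tensorGrading k 𝒜 ℬ 0, ∃ c : k, r * κ p = c • κ p := by
  refine ⟨fun p => ε p.1 ⊗ₜ[k] η p.2,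
    fun p => by simpa using tmul_mem_tensorGrading (hε₀ p.1) (hη₀ p.2), fun p => ?_, ?_,
    fun p r hr => exists_mul_tmul_eq_smul hA₀ hB₀ (hεk p.1) (hηk p.2) hr⟩
  · rw [Algebra.TensorProduct.tmul_mul_tmul, hε, hη]
  · simp_rw [Fintype.sum_prod_type, ← TensorProduct.tmul_sum, ← TensorProduct.sum_tmul, hε1,
      hη1, Algebra.TensorProduct.one_def]

end EnvelopingGrading

namespace GrMod

section Bar

variable {k : Type u} [Field k] {A B : Type u} [Ring A] [Algebra k A] [Ring B] [Algebra k B]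
  {𝒜 : ℤ → Submodule k A} {ℬ : ℤ → Submodule k B}

/-- The subspace `A_{>0} X` of a graded `A ⊗ B`-module `X`. -/
def leftPos (X : GrMod k (A ⊗[k] B) (tensorGrading k 𝒜 ℬ)) : Submodule k X.carrier :=
  Submodule.span k {z | ∃ i, 0 < i ∧ ∃ a ∈ 𝒜 i, ∃ x : X.carrier, z = (a ⊗ₜ[k] (1 : B)) • x}

lemma smul_mem_leftPos (X : GrMod k (A ⊗[k] B) (tensorGrading k 𝒜 ℬ)) {i : ℤ} (hi : 0 < i)
    {a : A} (ha : a ∈ 𝒜 i) (x : X.carrier) : (a ⊗ₜ[k] (1 : B)) • x ∈ X.leftPos :=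
  Submodule.subset_span ⟨i, hi, a, ha, x, rfl⟩

lemma map_mem_leftPos {X Y : GrMod k (A ⊗[k] B) (tensorGrading k 𝒜 ℬ)}
    (φ : X.carrier →ₗ[k] Y.carrier)
    (hφ : ∀ (a : A) x, φ ((a ⊗ₜ[k] (1 : B)) • x) = (a ⊗ₜ[k] (1 : B)) • φ x)
    {x : X.carrier} (hx : x ∈ X.leftPos) : φ x ∈ Y.leftPos := by
  suffices X.leftPos ≤ Y.leftPos.comap φ from this hx
  refine Submodule.span_le.2 ?_
  rintro _ ⟨i, hi, a, ha, x, rfl⟩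
  simp only [SetLike.mem_coe, Submodule.mem_comap, hφ]
  exact Y.smul_mem_leftPos hi ha _

lemma proj_mem_leftPos (h1B : (1 : B) ∈ ℬ 0) (X : GrMod k (A ⊗[k] B) (tensorGrading k 𝒜 ℬ))
    (n : ℤ) {x : X.carrier} (hx : x ∈ X.leftPos) : X.proj n x ∈ X.leftPos := by
  suffices X.leftPos ≤ X.leftPos.comap (X.proj n) from this hx
  refine Submodule.span_le.2 ?_
  rintro _ ⟨i, hi, a, ha, x, rfl⟩
  rw [SetLike.mem_coe, Submodule.mem_comap, X.proj_smul (tmul_mem_tensorGrading ha h1B)]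
  exact X.smul_mem_leftPos hi ha _

lemma leftPos_le_posPart (h1B : (1 : B) ∈ ℬ 0)
    (X : GrMod k (A ⊗[k] B) (tensorGrading k 𝒜 ℬ)) : X.leftPos ≤ X.posPart := by
  refine Submodule.span_le.2 ?_
  rintro _ ⟨i, hi, a, ha, x, rfl⟩
  exact X.smul_mem_posPart (by simpa using hi) (tmul_mem_tensorGrading ha h1B) x

/-- The subspace `A_{>0} X` as a `B`-submodule. -/
noncomputable def leftAug (h1A : (1 : A) ∈ 𝒜 0)
    (X : GrMod k (A ⊗[k] B) (tensorGrading k 𝒜 ℬ)) :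
    Submodule B (restrictRight h1A X).carrier :=
  { X.leftPos.toAddSubmonoid with
    smul_mem' := fun b x hx => by
      refine map_mem_leftPos (X.smulLin ((1 : A) ⊗ₜ[k] b)) (fun a y => ?_) hx
      simp only [smulLin_apply, ← mul_smul, Algebra.TensorProduct.tmul_mul_tmul, mul_one,
        one_mul] }

variable (h1A : (1 : A) ∈ 𝒜 0) (h1B : (1 : B) ∈ ℬ 0)

/-- The graded `B`-module `X / A_{>0} X` of a graded `A ⊗ B`-module `X`. -/
noncomputable def bar (X : GrMod k (A ⊗[k] B) (tensorGrading k 𝒜 ℬ)) : GrMod k B ℬ :=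
  (restrictRight h1A X).quotient (leftAug h1A X) fun n _ hx => proj_mem_leftPos h1B X n hx

/-- The quotient map `X → X / A_{>0} X`. -/
noncomputable def barMk (X : GrMod k (A ⊗[k] B) (tensorGrading k 𝒜 ℬ)) :
    X.carrier →ₗ[k] (bar h1A h1B X).carrier :=
  kLin (M := restrictRight h1A X) (quotientMk _ (leftAug h1A X) _).toLin

variable (X : GrMod k (A ⊗[k] B) (tensorGrading k 𝒜 ℬ))

lemma barMk_surjective : Function.Surjective (barMk h1A h1B X) :=
  Submodule.mkQ_surjective _

lemma barMk_eq_zero {x : X.carrier} : barMk h1A h1B X x = 0 ↔ x ∈ X.leftPos :=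
  Submodule.Quotient.mk_eq_zero (leftAug h1A X)

lemma barMk_one_tmul_smul (b : B) (x : X.carrier) :
    barMk h1A h1B X (((1 : A) ⊗ₜ[k] b) • x) = b • barMk h1A h1B X x := rfl

lemma bar_grading (n : ℤ) :
    (bar h1A h1B X).grading n = (X.grading n).map (barMk h1A h1B X) := rfl

lemma barMk_tmul_smul (a : A) (b : B) (x : X.carrier) :
    barMk h1A h1B X ((a ⊗ₜ[k] b) • x) = b • barMk h1A h1B X ((a ⊗ₜ[k] (1 : B)) • x) := by
  rw [← barMk_one_tmul_smul, ← mul_smul, Algebra.TensorProduct.tmul_mul_tmul, one_mul, mul_one]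

lemma bar_grading_eq_bot {c : ℤ} (hc : ∀ n < c, X.grading n = ⊥) :
    ∀ n < c, (bar h1A h1B X).grading n = ⊥ := fun n hn => by
  rw [bar_grading, hc n hn, Submodule.map_bot]

variable {X} {Y : GrMod k (A ⊗[k] B) (tensorGrading k 𝒜 ℬ)}

/-- A `B`-linear map out of `X / A_{>0} X`. -/
noncomputable def barLift {Q : Type*} [AddCommGroup Q] [Module B Q] (φ : X.carrier →+ Q)
    (hφ : ∀ (b : B) x, φ (((1 : A) ⊗ₜ[k] b) • x) = b • φ x) (h0 : ∀ x ∈ X.leftPos, φ x = 0) :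
    (bar h1A h1B X).carrier →ₗ[B] Q :=
  (leftAug h1A X).liftQ { toFun := φ, map_add' := φ.map_add, map_smul' := hφ } h0

/-- The morphism `X / A_{>0} X → Y / A_{>0} Y` induced by a morphism `X → Y`. -/
noncomputable def barMap (f : Hom X Y) : Hom (bar h1A h1B X) (bar h1A h1B Y) where
  toLin := barLift h1A h1B ((barMk h1A h1B Y).toAddMonoidHom.comp f.toLin.toAddMonoidHom)
    (fun b x => by
      change barMk h1A h1B Y (f.toLin _) = b • barMk h1A h1B Y (f.toLin x)
      rw [map_smul, barMk_one_tmul_smul])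
    (fun x hx => (barMk_eq_zero h1A h1B Y).2
      (map_mem_leftPos (kLin f.toLin) (fun a x => f.toLin.map_smul _ x) hx))
  map_grading n x hx := by
    obtain ⟨x, hx, rfl⟩ := hx
    exact ⟨f.toLin x, f.map_grading n x hx, rfl⟩

@[simp] lemma barMap_barMk (f : Hom X Y) (x : X.carrier) :
    (barMap h1A h1B f).toLin (barMk h1A h1B X x) = barMk h1A h1B Y (f.toLin x) := rfl

lemma barMap_surjective {f : Hom X Y} (hf : Function.Surjective f.toLin) :
    Function.Surjective (barMap h1A h1B f).toLin := fun y => by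
  obtain ⟨y, rfl⟩ := barMk_surjective h1A h1B Y y
  obtain ⟨x, rfl⟩ := hf y
  exact ⟨barMk h1A h1B X x, rfl⟩

variable (X) in
lemma barMk_mem_posPart (hA₀ : ∀ i < 0, 𝒜 i = ⊥) {x : X.carrier} (hx : x ∈ X.posPart) :
    barMk h1A h1B X x ∈ (bar h1A h1B X).posPart := by
  suffices X.posPart ≤ (bar h1A h1B X).posPart.comap (barMk h1A h1B X) from this hx
  refine Submodule.span_le.2 ?_
  rintro _ ⟨n, hn, t, ht, x, rfl⟩
  induction ht using Submodule.span_induction with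
  | zero => simp
  | add s t _ _ hs ht => rw [add_smul]; exact add_mem hs ht
  | smul c t _ ht => rw [smul_assoc]; exact Submodule.smul_mem _ c ht
  | mem t ht =>
    obtain ⟨i, j, a, b, ha, hb, rfl, rfl⟩ := ht
    rw [SetLike.mem_coe, Submodule.mem_comap, barMk_tmul_smul]
    rcases lt_trichotomy i 0 with hi | rfl | hi
    · rw [hA₀ i hi, Submodule.mem_bot] at ha
      simp [ha]
    · exact smul_mem_posPart _ (by simpa using hn) hb _
    · rw [(barMk_eq_zero h1A h1B X).2 (X.smul_mem_leftPos hi ha x), smul_zero]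
      exact zero_mem _

variable (X) in
lemma mem_posPart_of_barMk {x : X.carrier}
    (hx : barMk h1A h1B X x ∈ (bar h1A h1B X).posPart) : x ∈ X.posPart := by
  have h : (bar h1A h1B X).posPart ≤ X.posPart.map (barMk h1A h1B X) := by
    refine Submodule.span_le.2 ?_
    rintro _ ⟨n, hn, b, hb, y, rfl⟩
    obtain ⟨y, rfl⟩ := barMk_surjective h1A h1B X y
    exact ⟨((1 : A) ⊗ₜ[k] b) • y,
      X.smul_mem_posPart (by simpa using hn) (tmul_mem_tensorGrading h1A hb) y, rfl⟩
  obtain ⟨y, hy, hyx⟩ := h hx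
  have h2 : x - y ∈ X.leftPos := by
    rw [← barMk_eq_zero h1A h1B X, map_sub, hyx, sub_self]
  rw [← sub_add_cancel x y]
  exact add_mem (leftPos_le_posPart h1B X h2) hy

lemma barMk_smul_homProj (hA : DirectSum.IsInternal 𝒜) (hA₀ : ∀ i < 0, 𝒜 i = ⊥) (a : A)
    (x : X.carrier) :
    barMk h1A h1B X ((a ⊗ₜ[k] (1 : B)) • x) =
      barMk h1A h1B X ((homProj hA 0 a ⊗ₜ[k] (1 : B)) • x) := by
  refine isInternal_induction hA a (fun n a ha => ?_) (fun a b ha hb => ?_)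
  · rcases lt_trichotomy n 0 with hn | rfl | hn
    · rw [hA₀ n hn, Submodule.mem_bot] at ha
      simp [ha]
    · rw [homProj_of_mem hA ha]
    · rw [(barMk_eq_zero h1A h1B X).2 (X.smul_mem_leftPos hn ha x),
        homProj_of_mem_ne hA ha hn.ne', TensorProduct.zero_tmul, zero_smul, map_zero]
  · simp only [map_add, TensorProduct.add_tmul, add_smul, ha, hb]

lemma GeneratedIn.bar (hA : DirectSum.IsInternal 𝒜) (hA₀ : ∀ i < 0, 𝒜 i = ⊥) {T : Set ℤ}
    (h : X.GeneratedIn T) : (bar h1A h1B X).GeneratedIn T := by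
  rw [GeneratedIn, eq_top_iff]
  rintro y -
  obtain ⟨x, rfl⟩ := barMk_surjective h1A h1B X y
  set W := Submodule.span B (⋃ j ∈ T, ((GrMod.bar h1A h1B X).grading j : Set
    (GrMod.bar h1A h1B X).carrier))
  have hx : x ∈ Submodule.span (A ⊗[k] B) (⋃ j ∈ T, (X.grading j : Set X.carrier)) := by
    rw [h]; trivial
  suffices ∀ t : A ⊗[k] B, barMk h1A h1B X (t • x) ∈ W by simpa using this 1
  induction hx using Submodule.span_induction with
  | zero => intro t; simp
  | add x y _ _ hx hy => intro t; rw [smul_add, map_add]; exact add_mem (hx t) (hy t)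
  | smul r x _ hx => intro t; rw [← mul_smul]; exact hx _
  | mem x hx =>
    intro t
    simp only [Set.mem_iUnion, SetLike.mem_coe, exists_prop] at hx
    obtain ⟨j, hj, hx⟩ := hx
    induction t using TensorProduct.induction_on with
    | zero => simp
    | add s t hs ht => rw [add_smul, map_add]; exact add_mem hs ht
    | tmul a b =>
      rw [barMk_tmul_smul, barMk_smul_homProj h1A h1B hA hA₀]
      refine Submodule.smul_mem _ b (Submodule.subset_span ?_)
      simp only [Set.mem_iUnion, SetLike.mem_coe, exists_prop]
      refine ⟨j, hj, _, ?_, rfl⟩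
      change _ ∈ X.grading j
      simpa using X.smul_mem (tmul_mem_tensorGrading (homProj_mem hA 0 a) h1B) hx

lemma bar_projective (hA : DirectSum.IsInternal 𝒜) (hA₀ : ∀ i < 0, 𝒜 i = ⊥)
    (hmul : ∀ {i j : ℤ} {a b : A}, a ∈ 𝒜 i → b ∈ 𝒜 j → a * b ∈ 𝒜 (i + j))
    {J : Type*} [Fintype J] (ε : J → A) (c : J → A →ₗ[k] k)
    (hc : ∀ a, homProj hA 0 a = ∑ j, c j a • ε j)
    (hc0 : ∀ a, homProj hA 0 a = 0 → ∀ j, c j a = 0)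
    (hX : Module.Projective (A ⊗[k] B) X.carrier) :
    Module.Projective B (bar h1A h1B X).carrier := by
  classical
  obtain ⟨s, hs⟩ := Module.projective_def.1 hX
  let Φ (j : J) : A ⊗[k] B →ₗ[k] B := TensorProduct.lid k B ∘ₗ TensorProduct.map (c j) .id
  have hΦ : ∀ j a b, Φ j (a ⊗ₜ b) = c j a • b := fun j a b => by simp [Φ]
  have hΦ1 : ∀ j b t, Φ j (((1 : A) ⊗ₜ[k] b) * t) = b * Φ j t := fun j b t => by
    induction t using TensorProduct.induction_on with
    | zero => simp
    | add s t hs ht => rw [mul_add, map_add, map_add, mul_add, hs, ht]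
    | tmul a' b' => simp [hΦ]
  have hΦ0 : ∀ j i, 0 < i → ∀ a ∈ 𝒜 i, ∀ t, Φ j ((a ⊗ₜ[k] (1 : B)) * t) = 0 := by
    intro j i hi a ha t
    induction t using TensorProduct.induction_on with
    | zero => simp
    | add s t hs ht => rw [mul_add, map_add, hs, ht, add_zero]
    | tmul a' b' =>
      rw [Algebra.TensorProduct.tmul_mul_tmul, hΦ, hc0, zero_smul]
      refine isInternal_induction hA a' (fun n a' ha' => ?_) (fun y z hy hz => ?_)
      · rcases lt_or_ge n 0 with hn | hn
        · rw [hA₀ n hn, Submodule.mem_bot] at ha'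
          simp [ha']
        · exact homProj_of_mem_ne hA (hmul ha ha') (by omega)
      · rw [mul_add, map_add, hy, hz, add_zero]
  have key : ∀ (t : A ⊗[k] B) (q : X.carrier),
      ∑ j, Φ j t • barMk h1A h1B X ((ε j ⊗ₜ[k] (1 : B)) • q) = barMk h1A h1B X (t • q) := by
    intro t q
    induction t using TensorProduct.induction_on with
    | zero => simp
    | add s t hs ht => simp only [map_add, add_smul, Finset.sum_add_distrib, hs, ht]
    | tmul a b =>
      rw [barMk_tmul_smul, barMk_smul_homProj h1A h1B hA hA₀, hc, TensorProduct.sum_tmul,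
        Finset.sum_smul, map_sum, Finset.smul_sum]
      refine Finset.sum_congr rfl fun j _ => ?_
      rw [hΦ, ← TensorProduct.smul_tmul', smul_assoc (c j a) b,
        smul_assoc (c j a) (ε j ⊗ₜ[k] (1 : B)), (barMk h1A h1B X).map_smul]
      exact ((smulLin (bar h1A h1B X) b).map_smul (c j a) _).symm
  let Θ : (bar h1A h1B X).carrier →ₗ[B] (X.carrier →₀ (J → B)) :=
    barLift h1A h1B ((Finsupp.mapRange.addMonoidHom
        (LinearMap.pi Φ).toAddMonoidHom).comp s.toAddMonoidHom)
      (fun b x => by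
        ext q j
        simpa using hΦ1 j b (s x q))
      (fun x hx => by
        induction hx using Submodule.span_induction with
        | zero => simp
        | add x y _ _ hx hy => rw [map_add, hx, hy, add_zero]
        | smul r x _ hx =>
          ext q j
          have h := DFunLike.congr_fun hx q
          have h := congrFun h j
          rw [← X.central]
          simp only [AddMonoidHom.comp_apply, LinearMap.toAddMonoidHom_coe, map_smul] at h ⊢
          simp only [Finsupp.mapRange.addMonoidHom_apply, Finsupp.mapRange_apply,
            LinearMap.toAddMonoidHom_coe, LinearMap.pi_apply, Finsupp.smul_apply, smul_eq_mul,
            ← Algebra.smul_def, map_smul] at h ⊢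
          rw [h]; simp
        | mem x hx =>
          obtain ⟨i, hi, a, ha, x, rfl⟩ := hx
          ext q j
          simpa using hΦ0 j i hi a ha (s x q))
  let Ψ : (X.carrier →₀ (J → B)) →ₗ[B] (bar h1A h1B X).carrier :=
    Finsupp.lsum ℕ fun q => ∑ j, (LinearMap.toSpanSingleton B _
      (barMk h1A h1B X ((ε j ⊗ₜ[k] (1 : B)) • q))) ∘ₗ LinearMap.proj j
  refine Module.Projective.of_split Θ Ψ (LinearMap.ext fun y => ?_)
  obtain ⟨x, rfl⟩ := barMk_surjective h1A h1B X y
  have : Θ (barMk h1A h1B X x) = (s x).mapRange (LinearMap.pi Φ) (map_zero _) := rfl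
  rw [LinearMap.comp_apply, this, LinearMap.id_apply]
  simp only [Ψ, Finsupp.coe_lsum]
  rw [Finsupp.sum_mapRange_index (by simp)]
  simp only [LinearMap.sum_apply, LinearMap.comp_apply, LinearMap.proj_apply,
    LinearMap.pi_apply, LinearMap.toSpanSingleton_apply, key]
  rw [← map_finsuppSum]
  exact congrArg _ (hs x)

end Bar

end GrMod

namespace GrMod

section LeftProjective

variable {k : Type u} [Field k] {A B : Type u} [Ring A] [Algebra k A] [Ring B] [Algebra k B]
  {𝒜 : ℤ → Submodule k A} {ℬ : ℤ → Submodule k B}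

/-- An `A ⊗ B`-module is left projective if it is projective as an `A`-module. -/
def LeftProjective (h1B : (1 : B) ∈ ℬ 0) (X : GrMod k (A ⊗[k] B) (tensorGrading k 𝒜 ℬ)) :
    Prop :=
  Module.Projective A (restrictLeft h1B X).carrier

/-- A `k`-linear map commuting with `A`, as an `A`-linear map between restricted modules. -/
def leftLin (h1B : (1 : B) ∈ ℬ 0) {X Y : GrMod k (A ⊗[k] B) (tensorGrading k 𝒜 ℬ)}
    (φ : X.carrier →ₗ[k] Y.carrier)
    (hφ : ∀ (a : A) x, φ ((a ⊗ₜ[k] (1 : B)) • x) = (a ⊗ₜ[k] (1 : B)) • φ x) :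
    (restrictLeft h1B X).carrier →ₗ[A] (restrictLeft h1B Y).carrier where
  toFun := φ
  map_add' := φ.map_add
  map_smul' := hφ

variable {h1B : (1 : B) ∈ ℬ 0} {X P K : GrMod k (A ⊗[k] B) (tensorGrading k 𝒜 ℬ)}

lemma LeftProjective.of_projective (hP : Module.Projective (A ⊗[k] B) P.carrier) :
    LeftProjective h1B P := by
  obtain ⟨s, hs⟩ := Module.projective_def.1 hP
  have hsmul : ∀ (a : A) (t : A ⊗[k] B), (a ⊗ₜ[k] (1 : B)) * t = a • t := fun a t => by
    induction t using TensorProduct.induction_on with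
    | zero => simp
    | add s t hs ht => rw [mul_add, smul_add, hs, ht]
    | tmul a' b' => simp [TensorProduct.smul_tmul']
  let i : (restrictLeft h1B P).carrier →ₗ[A] (P.carrier →₀ A ⊗[k] B) :=
    { toFun := s
      map_add' := s.map_add
      map_smul' := fun a x => (s.map_smul (a ⊗ₜ[k] (1 : B)) x).trans
        (Finsupp.ext fun q => hsmul a (s x q)) }
  let p : (P.carrier →₀ A ⊗[k] B) →ₗ[A] (restrictLeft h1B P).carrier :=
    { toFun := Finsupp.linearCombination (A ⊗[k] B) _root_.id
      map_add' := map_add _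
      map_smul' := fun a x => by
        have h : a • x = (a ⊗ₜ[k] (1 : B)) • x := Finsupp.ext fun q => (hsmul a (x q)).symm
        rw [h, map_smul]
        rfl }
  exact Module.Projective.of_split i p (LinearMap.ext hs)

lemma LeftProjective.exists_section (hX : LeftProjective h1B X) (f : Hom P X)
    (hf : Function.Surjective f.toLin) :
    ∃ s : X.carrier →ₗ[k] P.carrier,
      (∀ (a : A) x, s ((a ⊗ₜ[k] (1 : B)) • x) = (a ⊗ₜ[k] (1 : B)) • s x) ∧
      ∀ x, f.toLin (s x) = x := by
  have : Module.Projective A (restrictLeft h1B X).carrier := hX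
  obtain ⟨s, hs⟩ := Module.projective_lifting_property
    (leftLin h1B (kLin f.toLin) fun a x => f.toLin.map_smul _ x) LinearMap.id hf
  exact ⟨kLin (M := restrictLeft h1B X) (N := restrictLeft h1B P) s, s.map_smul,
    LinearMap.congr_fun hs⟩

lemma LeftProjective.exists_retraction (hX : LeftProjective h1B X) (f : Hom P X) (i : Hom K P)
    (hf : Function.Surjective f.toLin) (hi : Function.Injective i.toLin)
    (hex : Function.Exact i.toLin f.toLin) :
    ∃ (s : X.carrier →ₗ[k] P.carrier) (ρ : P.carrier →ₗ[k] K.carrier),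
      (∀ (a : A) x, s ((a ⊗ₜ[k] (1 : B)) • x) = (a ⊗ₜ[k] (1 : B)) • s x) ∧
      (∀ (a : A) x, ρ ((a ⊗ₜ[k] (1 : B)) • x) = (a ⊗ₜ[k] (1 : B)) • ρ x) ∧
      (∀ p, i.toLin (ρ p) + s (f.toLin p) = p) ∧ ∀ y, ρ (i.toLin y) = y := by
  obtain ⟨s, hsa, hs⟩ := hX.exists_section f hf
  have h : ∀ p, ∃ y, i.toLin y = p - s (f.toLin p) := fun p =>
    (hex _).1 (by rw [map_sub, hs, sub_self])
  choose ρ hρ using h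
  refine ⟨s, { toFun := ρ, map_add' := fun p q => hi ?_, map_smul' := fun c p => hi ?_ },
    hsa, fun a p => hi ?_, fun p => ?_, fun y => hi ?_⟩
  · rw [map_add, hρ, hρ, hρ, map_add, map_add]; abel
  · rw [RingHom.id_apply, ← kLin_apply i.toLin, ← kLin_apply i.toLin, map_smul, kLin_apply,
      kLin_apply, hρ, hρ, smul_sub, ← kLin_apply f.toLin, map_smul, map_smul, kLin_apply]
  · change i.toLin (ρ _) = i.toLin (_ • ρ _)
    rw [map_smul, hρ, hρ, map_smul, hsa, smul_sub]
  · change i.toLin (ρ p) + _ = p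
    rw [hρ, sub_add_cancel]
  · change i.toLin (ρ _) = _
    rw [hρ, (hex _).2 ⟨y, rfl⟩, map_zero, sub_zero]

variable (h1A : (1 : A) ∈ 𝒜 0)

/-- The functor `X ↦ X / A_{>0} X` preserves short exact sequences of left projective
modules. -/
lemma LeftProjective.bar_exact (hX : LeftProjective h1B X) (hP : LeftProjective h1B P)
    (f : Hom P X) (i : Hom K P)
    (hf : Function.Surjective f.toLin) (hi : Function.Injective i.toLin)
    (hex : Function.Exact i.toLin f.toLin) :
    LeftProjective h1B K ∧ Function.Injective (barMap h1A h1B i).toLin ∧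
      Function.Exact (barMap h1A h1B i).toLin (barMap h1A h1B f).toLin := by
  obtain ⟨s, ρ, hs, hρ, hsum, hρi⟩ := hX.exists_retraction f i hf hi hex
  refine ⟨?_, ?_, fun y => ⟨fun hy => ?_, ?_⟩⟩
  · have : Module.Projective A (restrictLeft h1B P).carrier := hP
    exact Module.Projective.of_split
      (leftLin h1B (kLin i.toLin) fun a x => i.toLin.map_smul _ x) (leftLin h1B ρ hρ)
      (LinearMap.ext hρi)
  · rw [injective_iff_map_eq_zero]
    intro y hy
    obtain ⟨y, rfl⟩ := barMk_surjective h1A h1B K y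
    rw [barMap_barMk, barMk_eq_zero] at hy
    rw [barMk_eq_zero, ← hρi y]
    exact map_mem_leftPos ρ hρ hy
  · obtain ⟨p, rfl⟩ := barMk_surjective h1A h1B P y
    rw [barMap_barMk, barMk_eq_zero] at hy
    refine ⟨barMk h1A h1B K (ρ p), ?_⟩
    conv_rhs => rw [← hsum p]
    rw [barMap_barMk, map_add, (barMk_eq_zero h1A h1B P).2 (map_mem_leftPos s hs hy), add_zero]
  · rintro ⟨y, rfl⟩
    obtain ⟨y, rfl⟩ := barMk_surjective h1A h1B K y
    rw [barMap_barMk, barMap_barMk, (hex _).2 ⟨y, rfl⟩, map_zero]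

variable {J : Type*} [Fintype J]

/-- If `X` is left projective and `S`-determined, then `X / A_{>0} X` is `S`-determined. -/
lemma SDetermined.bar (hA : DirectSum.IsInternal 𝒜) (hA₀ : ∀ i < 0, 𝒜 i = ⊥)
    (hmul : ∀ {i j : ℤ} {a b : A}, a ∈ 𝒜 i → b ∈ 𝒜 j → a * b ∈ 𝒜 (i + j))
    (ε : J → A) (c : J → A →ₗ[k] k)
    (hc : ∀ a, homProj hA 0 a = ∑ j, c j a • ε j)
    (hc0 : ∀ a, homProj hA 0 a = 0 → ∀ j, c j a = 0)
    {S : ℕ → Set ℤ} (hX : LeftProjective h1B X) (h : SDetermined S X) :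
    SDetermined S (bar h1A h1B X) := by
  refine sDetermined_of_step (fun S Y => ∃ X : GrMod k (A ⊗[k] B) (tensorGrading k 𝒜 ℬ),
    LeftProjective h1B X ∧ SDetermined S X ∧ Y = GrMod.bar h1A h1B X) ?_ ⟨X, hX, h, rfl⟩
  rintro S _ ⟨X, hX, h, rfl⟩
  obtain ⟨P, f, hP, hgen, hf, hK⟩ := h.exists_step
  obtain ⟨hKp, hinj, hex⟩ := hX.bar_exact h1A (.of_projective hP) f f.kerIncl hf
    f.kerIncl_injective f.exact_kerIncl
  exact ⟨GrMod.bar h1A h1B P, GrMod.bar h1A h1B f.ker, barMap h1A h1B f,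
    barMap h1A h1B f.kerIncl, bar_projective h1A h1B hA hA₀ hmul ε c hc hc0 hP,
    hgen.bar h1A h1B hA hA₀, barMap_surjective h1A h1B hf, hinj, hex, f.ker, hKp, hK, rfl⟩

/-- If `X` is left projective and bounded below and `X / A_{>0} X` is `S`-determined, then so
is `X`. -/
lemma SDetermined.of_bar (hA : DirectSum.IsInternal 𝒜) (hA₀ : ∀ i < 0, 𝒜 i = ⊥)
    (hAmul : ∀ {i j : ℤ} {a b : A}, a ∈ 𝒜 i → b ∈ 𝒜 j → a * b ∈ 𝒜 (i + j))
    (ε : J → A) (hε₀ : ∀ j, ε j ∈ 𝒜 0) (hε : ∀ j, ε j * ε j = ε j) (hε1 : ∑ j, ε j = 1)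
    (c : J → A →ₗ[k] k) (hεk : ∀ j, ∀ a ∈ 𝒜 0, a * ε j = c j a • ε j)
    (hc : ∀ a, homProj hA 0 a = ∑ j, c j a • ε j)
    (hc0 : ∀ a, homProj hA 0 a = 0 → ∀ j, c j a = 0)
    (hB : DirectSum.IsInternal ℬ) (hB₀ : ∀ i < 0, ℬ i = ⊥)
    (hBmul : ∀ {i j : ℤ} {a b : B}, a ∈ ℬ i → b ∈ ℬ j → a * b ∈ ℬ (i + j))
    (η : J → B) (hη₀ : ∀ j, η j ∈ ℬ 0) (hη : ∀ j, η j * η j = η j) (hη1 : ∑ j, η j = 1)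
    (hηk : ∀ j, ∀ b ∈ ℬ 0, ∃ c : k, b * η j = c • η j)
    {S : ℕ → Set ℤ} (hX : LeftProjective h1B X) {b : ℤ} (hb : ∀ n < b, X.grading n = ⊥)
    (h : SDetermined S (GrMod.bar h1A h1B X)) : SDetermined S X := by
  have htopB : ∀ r : B, r ∈ ⨆ n, ℬ n := fun r => by rw [hB.submodule_iSup_eq_top]; trivial
  refine sDetermined_of_step (fun S X => LeftProjective h1B X ∧ (∀ n < b, X.grading n = ⊥) ∧
    SDetermined S (GrMod.bar h1A h1B X)) ?_ ⟨hX, hb, h⟩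
  rintro S X ⟨hX, hb, h⟩
  obtain ⟨Q, g, -, hgen, hg, -⟩ := h.exists_step
  have hT : ∀ n, n ∉ S 0 → ∀ x ∈ X.grading n, x ∈ X.posPart := fun n hn x hx =>
    mem_posPart_of_barMk h1A h1B X
      ((hgen.of_surjective g hg).mem_posPart htopB hB₀ hn ⟨x, hx, rfl⟩)
  obtain ⟨κ, hκ₀, hκ, hκ1, hκk⟩ := exists_tensor_idempotents hA₀ hB₀ ε hε₀ hε hε1
    (fun j a ha => ⟨_, hεk j a ha⟩) η hη₀ hη hη1 hηk
  obtain ⟨P, f, hP, hPgen, hf, hmin, hPb⟩ := exists_projective_cover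
    (R := A ⊗[k] B) (𝒜 := tensorGrading k 𝒜 ℬ)
    (tensorGrading_isInternal hA hB hA₀ hB₀) (tensorGrading_eq_bot hA₀ hB₀)
    (tensorGrading_mul_mem hAmul hBmul) κ hκ₀ hκ hκ1 hκk X hb hT
  obtain ⟨hKp, hinj, hex⟩ := hX.bar_exact h1A (.of_projective hP) f f.kerIncl hf
    f.kerIncl_injective f.exact_kerIncl
  have hPbar : Module.Projective B (GrMod.bar h1A h1B P).carrier :=
    bar_projective h1A h1B hA hA₀ hAmul ε c hc hc0 hP
  refine ⟨P, f.ker, f, f.kerIncl, hP, hPgen, hf, f.kerIncl_injective, f.exact_kerIncl, hKp,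
    fun n hn => ?_, h.of_minimal htopB (barMap h1A h1B f) (barMap h1A h1B f.kerIncl)
      (barMap_surjective h1A h1B hf) hinj hex (fun y hy => ?_)
      (bar_grading_eq_bot h1A h1B P hPb)⟩
  · refine eq_bot_iff.2 fun x hx => f.kerIncl_injective ?_
    have := f.kerIncl.map_grading n x hx
    rw [hPb n hn, Submodule.mem_bot] at this
    rw [this, map_zero]
  · obtain ⟨y, rfl⟩ := (hex _).1 hy
    obtain ⟨y, rfl⟩ := barMk_surjective h1A h1B f.ker y
    rw [barMap_barMk]
    exact barMk_mem_posPart h1A h1B P hA₀ (hmin _ ((f.exact_kerIncl _).2 ⟨y, rfl⟩))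

end LeftProjective

end GrMod

section Idempotents

variable {k : Type u} [Field k] {A : Type u} [Ring A] [Algebra k A] {𝒜 : ℤ → Submodule k A}

/-- The primitive idempotents of a degree-zero part that is a product of copies of `k`,
together with the coordinate functionals. -/
lemma exists_idempotents (hA : DirectSum.IsInternal 𝒜) (h1 : (1 : A) ∈ 𝒜 0)
    (hmul : ∀ {i j : ℤ} {a b : A}, a ∈ 𝒜 i → b ∈ 𝒜 j → a * b ∈ 𝒜 (i + j))
    {n : ℕ} (e : 𝒜 0 ≃ₗ[k] (Fin n → k))
    (he : ∀ (x y : A) (hx : x ∈ 𝒜 0) (hy : y ∈ 𝒜 0) (hxy : x * y ∈ 𝒜 0),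
      e ⟨x * y, hxy⟩ = e ⟨x, hx⟩ * e ⟨y, hy⟩) :
    ∃ (ε : Fin n → A) (c : Fin n → A →ₗ[k] k), (∀ j, ε j ∈ 𝒜 0) ∧ (∀ j, ε j * ε j = ε j) ∧
      ∑ j, ε j = 1 ∧ (∀ a, homProj hA 0 a = ∑ j, c j a • ε j) ∧
      (∀ a, homProj hA 0 a = 0 → ∀ j, c j a = 0) ∧
      (∀ j, ∀ a ∈ 𝒜 0, a * ε j = c j a • ε j) ∧ ∀ j, ∀ a ∈ 𝒜 0, ε j * a = c j a • ε j := by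
  have hmul0 : ∀ {x y : A}, x ∈ 𝒜 0 → y ∈ 𝒜 0 → x * y ∈ 𝒜 0 := fun hx hy => by
    simpa using hmul hx hy
  have he1 : e ⟨1, h1⟩ = 1 := by
    have hy := (e.symm 1).2
    have h := he 1 (e.symm 1) h1 hy (hmul0 h1 hy)
    simp only [one_mul, Subtype.coe_eta, LinearEquiv.apply_symm_apply, mul_one] at h
    exact h.symm
  have hext : ∀ {x y : A} (hx : x ∈ 𝒜 0) (hy : y ∈ 𝒜 0), e ⟨x, hx⟩ = e ⟨y, hy⟩ → x = y :=
    fun hx hy h => congrArg Subtype.val (e.injective h)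
  let ε (j : Fin n) : A := e.symm (Pi.single j 1)
  have hε₀ : ∀ j, ε j ∈ 𝒜 0 := fun j => Subtype.property _
  have heε : ∀ j (h : ε j ∈ 𝒜 0), e ⟨ε j, h⟩ = Pi.single j 1 := fun j h =>
    e.apply_symm_apply _
  let c (j : Fin n) : A →ₗ[k] k :=
    LinearMap.proj j ∘ₗ e.toLinearMap ∘ₗ (homProj hA 0).codRestrict (𝒜 0) (homProj_mem hA 0)
  have hcA : ∀ j a, c j a = e ⟨homProj hA 0 a, homProj_mem hA 0 a⟩ j := fun j a => rfl
  have hc0 : ∀ j a (ha : a ∈ 𝒜 0), c j a = e ⟨a, ha⟩ j := fun j a ha => by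
    simp only [hcA, homProj_of_mem hA ha]
  have hsum : ∀ a (ha : a ∈ 𝒜 0), a = ∑ j, e ⟨a, ha⟩ j • ε j := fun a ha => by
    have h : (⟨a, ha⟩ : 𝒜 0) = ∑ j, e ⟨a, ha⟩ j • e.symm (Pi.single j 1) := by
      apply e.injective
      simp only [map_sum, map_smul, LinearEquiv.apply_symm_apply]
      exact pi_eq_sum_univ' _
    simpa [ε] using congrArg Subtype.val h
  refine ⟨ε, c, hε₀, fun j => ?_, ?_, fun a => ?_, fun a ha j => ?_, fun j a ha => ?_,
    fun j a ha => ?_⟩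
  · refine hext (hmul0 (hε₀ j) (hε₀ j)) (hε₀ j) ?_
    rw [he _ _ (hε₀ j) (hε₀ j), heε, ← Pi.single_mul, one_mul]
  · rw [hsum 1 h1, he1]
    simp
  · exact hsum _ (homProj_mem hA 0 a)
  · have : (⟨homProj hA 0 a, homProj_mem hA 0 a⟩ : 𝒜 0) = 0 := Subtype.ext ha
    rw [hcA, this, map_zero, Pi.zero_apply]
  · refine hext (hmul0 ha (hε₀ j)) (Submodule.smul_mem _ _ (hε₀ j)) ?_
    have : e ⟨c j a • ε j, Submodule.smul_mem _ _ (hε₀ j)⟩ = c j a • e ⟨ε j, hε₀ j⟩ :=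
      e.map_smul (c j a) ⟨ε j, hε₀ j⟩
    rw [he _ _ ha (hε₀ j), this, heε, hc0 j a ha]
    ext i
    by_cases h : i = j
    · subst h; simp
    · simp [h]
  · refine hext (hmul0 (hε₀ j) ha) (Submodule.smul_mem _ _ (hε₀ j)) ?_
    have : e ⟨c j a • ε j, Submodule.smul_mem _ _ (hε₀ j)⟩ = c j a • e ⟨ε j, hε₀ j⟩ :=
      e.map_smul (c j a) ⟨ε j, hε₀ j⟩
    rw [he _ _ (hε₀ j) ha, this, heε, hc0 j a ha]
    ext i
    by_cases h : i = j
    · subst h; simp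
    · simp [h]

end Idempotents

namespace GrMod

section DiagonalBimodule

variable {k : Type u} [Field k] {A : Type u} [Ring A] [Algebra k A] {𝒜 : ℤ → Submodule k A}
  (M : GrMod k (A ⊗[k] Aᵐᵒᵖ) (tensorGrading k 𝒜 (opGrading k 𝒜))) (e : M.carrier ≃ₗ[k] A)

lemma leftProjective_diagonal (h1op : (1 : Aᵐᵒᵖ) ∈ opGrading k 𝒜 0)
    (heact : ∀ (a b : A) (m : M.carrier),
      e ((a ⊗ₜ[k] MulOpposite.op b) • m) = a * e m * b) : LeftProjective h1op M := by
  let E : (restrictLeft h1op M).carrier ≃ₗ[A] A :=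
    { e.toAddEquiv with
      map_smul' := fun a m => (heact a 1 m).trans (mul_one _) }
  exact Module.Projective.of_equiv E.symm

lemma mem_leftPos_diagonal (hA : DirectSum.IsInternal 𝒜) (hA₀ : ∀ i < 0, 𝒜 i = ⊥)
    (hmul : ∀ {i j : ℤ} {a b : A}, a ∈ 𝒜 i → b ∈ 𝒜 j → a * b ∈ 𝒜 (i + j))
    (heact : ∀ (a b : A) (m : M.carrier),
      e ((a ⊗ₜ[k] MulOpposite.op b) • m) = a * e m * b) (m : M.carrier) :
    m ∈ M.leftPos ↔ e m ∈ ⨆ (i : ℤ) (_ : i ≠ 0), 𝒜 i := by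
  have hsmul : ∀ (a : A) m, e ((a ⊗ₜ[k] (1 : Aᵐᵒᵖ)) • m) = a * e m := fun a m => by
    rw [← MulOpposite.op_one, heact, mul_one]
  constructor
  · intro hm
    suffices M.leftPos ≤ (⨆ (i : ℤ) (_ : i ≠ 0), 𝒜 i).comap e.toLinearMap from this hm
    refine Submodule.span_le.2 ?_
    rintro _ ⟨i, hi, a, ha, x, rfl⟩
    rw [SetLike.mem_coe, Submodule.mem_comap, LinearEquiv.coe_coe, hsmul]
    refine isInternal_induction hA (e x) (fun j y hy => ?_) (fun y z hy hz => ?_)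
    · rcases lt_or_ge j 0 with hj | hj
      · rw [hA₀ j hj, Submodule.mem_bot] at hy
        rw [hy, mul_zero]
        exact zero_mem _
      · exact Submodule.mem_iSup_of_mem (i + j)
          (Submodule.mem_iSup_of_mem (by omega) (hmul ha hy))
    · rw [mul_add]
      exact add_mem hy hz
  · intro hm
    suffices ⨆ (i : ℤ) (_ : i ≠ 0), 𝒜 i ≤ M.leftPos.comap e.symm.toLinearMap by
      simpa using this hm
    refine iSup₂_le fun i hi a ha => ?_
    rcases lt_or_ge i 0 with hi' | hi'
    · rw [hA₀ i hi', Submodule.mem_bot] at ha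
      rw [ha]
      exact zero_mem _
    · have : e.symm a = (a ⊗ₜ[k] (1 : Aᵐᵒᵖ)) • e.symm 1 := by
        apply e.injective
        rw [hsmul, e.apply_symm_apply, e.apply_symm_apply, mul_one]
      rw [Submodule.mem_comap, LinearEquiv.coe_coe, this]
      exact M.smul_mem_leftPos (lt_of_le_of_ne hi' hi.symm) ha _

lemma exists_bar_diagonal_bijective (h1 : (1 : A) ∈ 𝒜 0) (h1op : (1 : Aᵐᵒᵖ) ∈ opGrading k 𝒜 0)
    (hA : DirectSum.IsInternal 𝒜) (hA₀ : ∀ i < 0, 𝒜 i = ⊥)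
    (hmul : ∀ {i j : ℤ} {a b : A}, a ∈ 𝒜 i → b ∈ 𝒜 j → a * b ∈ 𝒜 (i + j))
    (heact : ∀ (a b : A) (m : M.carrier),
      e ((a ⊗ₜ[k] MulOpposite.op b) • m) = a * e m * b)
    (hegr : ∀ n : ℤ, (M.grading n).map (e : M.carrier →ₗ[k] A) = 𝒜 n)
    (N : GrMod k Aᵐᵒᵖ (opGrading k 𝒜)) (π : A →ₗ[k] N.carrier)
    (hπsurj : Function.Surjective π)
    (hπker : LinearMap.ker π = ⨆ (i : ℤ) (_ : i ≠ 0), 𝒜 i)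
    (hπact : ∀ (a x : A), π (x * a) = (MulOpposite.op a) • π x)
    (hπgr : ∀ n : ℤ, N.grading n = (𝒜 n).map π) :
    ∃ g : Hom (bar h1 h1op M) N, Function.Bijective g.toLin := by
  have hπe : ∀ m, π (e m) = 0 ↔ m ∈ M.leftPos := fun m => by
    rw [mem_leftPos_diagonal M e hA hA₀ hmul heact, ← hπker, LinearMap.mem_ker]
  let g : Hom (bar h1 h1op M) N :=
    { toLin := barLift h1 h1op (π ∘ₗ e.toLinearMap).toAddMonoidHom
        (fun b m => by
          change π (e (_ ⊗ₜ MulOpposite.op b.unop • m)) = b • π (e m)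
          rw [heact, one_mul, hπact, MulOpposite.op_unop])
        (fun m hm => (hπe m).2 hm)
      map_grading := fun n y hy => by
        obtain ⟨m, hm, rfl⟩ := hy
        rw [hπgr, ← hegr]
        exact ⟨e m, ⟨m, hm, rfl⟩, rfl⟩ }
  have hg : ∀ m, g.toLin (barMk h1 h1op M m) = π (e m) := fun m => rfl
  refine ⟨g, (injective_iff_map_eq_zero _).2 fun y hy => ?_, fun y => ?_⟩
  · obtain ⟨m, rfl⟩ := barMk_surjective h1 h1op M y
    rw [hg, hπe] at hy
    exact (barMk_eq_zero h1 h1op M).2 hy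
  · obtain ⟨a, rfl⟩ := hπsurj y
    exact ⟨barMk h1 h1op M (e.symm a), by rw [hg, e.apply_symm_apply]⟩

end DiagonalBimodule

lemma sDetermined_congr {k : Type u} [Field k] {R : Type u} [Ring R] [Algebra k R]
    {𝒜 : ℤ → Submodule k R} {S : ℕ → Set ℤ} {X Y : GrMod k R 𝒜} (g : Hom X Y)
    (hg : Function.Bijective g.toLin) : SDetermined S X ↔ SDetermined S Y := by
  obtain ⟨h, hh⟩ := g.exists_lift hg.1 (Hom.id Y) hg.2
  refine ⟨fun hX => hX.of_bijective g hg, fun hY => hY.of_bijective h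
    ⟨Function.LeftInverse.injective hh, fun x => ⟨g.toLin x, hg.1 (hh _)⟩⟩⟩

end GrMod

/-- `A₀` is an `S`-determined right `A`-module if and only if `A` is an
`S`-determined graded module over the enveloping algebra `A ⊗ Aᵐᵒᵖ`. Here `N` is "the"
graded right `A`-module `A₀ = A/A_{>0}` (characterized by the projection `π`), and `M` is
"the" graded `A`-bimodule `A` (characterized by the `k`-linear isomorphism `e`). -/
theorem sDetermined_iff_bimodule_sDetermined {k : Type u} [Field k]
    {A : Type u} [Ring A] [Algebra k A] (𝒜 : ℤ → Submodule k A) [GradedAlgebra 𝒜]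
    (hstd : StdGraded k 𝒜) (S : ℕ → Set ℤ)
    -- `N` is the graded right `A`-module `A₀`
    (N : GrMod k Aᵐᵒᵖ (opGrading k 𝒜)) (π : A →ₗ[k] N.carrier)
    (hπsurj : Function.Surjective π)
    (hπker : LinearMap.ker π = ⨆ (i : ℤ) (_ : i ≠ 0), 𝒜 i)
    (hπact : ∀ (a x : A), π (x * a) = (MulOpposite.op a) • π x)
    (hπgr : ∀ n : ℤ, N.grading n = (𝒜 n).map π)
    -- `M` is `A` as a graded bimodule over `A ⊗ Aᵐᵒᵖ`
    (M : GrMod k (A ⊗[k] Aᵐᵒᵖ) (tensorGrading k 𝒜 (opGrading k 𝒜)))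
    (e : M.carrier ≃ₗ[k] A)
    (heact : ∀ (a b : A) (m : M.carrier),
      e ((a ⊗ₜ[k] MulOpposite.op b) • m) = a * e m * b)
    (hegr : ∀ n : ℤ, (M.grading n).map (e : M.carrier →ₗ[k] A) = 𝒜 n) :
    GrMod.SDetermined S N ↔ GrMod.SDetermined S M := by
  obtain ⟨hA₀, -, ⟨n, e₀, he₀⟩, -⟩ := hstd
  have hA : DirectSum.IsInternal 𝒜 := DirectSum.Decomposition.isInternal 𝒜
  have hmul : ∀ {i j : ℤ} {a b : A}, a ∈ 𝒜 i → b ∈ 𝒜 j → a * b ∈ 𝒜 (i + j) :=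
    fun ha hb => SetLike.mul_mem_graded ha hb
  have h1 : (1 : A) ∈ 𝒜 0 := SetLike.one_mem_graded 𝒜
  have h1op : (1 : Aᵐᵒᵖ) ∈ opGrading k 𝒜 0 := op_mem_opGrading h1
  obtain ⟨ε, c, hε₀, hε, hε1, hc, hc0, hεl, hεr⟩ := exists_idempotents hA h1 hmul e₀ he₀
  have hMp := GrMod.leftProjective_diagonal M e h1op heact
  obtain ⟨g, hg⟩ := GrMod.exists_bar_diagonal_bijective M e h1 h1op hA hA₀ hmul heact hegr N π
    hπsurj hπker hπact hπgr
  rw [← GrMod.sDetermined_congr g hg]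
  have hM₀ : ∀ n < 0, M.grading n = ⊥ := fun n hn => by
    rw [← (M.grading n).map_eq_bot_iff (e := e), hegr, hA₀ n hn]
  obtain ⟨η, hη₀, hη, hη1, hηk⟩ : ∃ η : Fin n → Aᵐᵒᵖ, (∀ j, η j ∈ opGrading k 𝒜 0) ∧
      (∀ j, η j * η j = η j) ∧ ∑ j, η j = 1 ∧
      ∀ j, ∀ b ∈ opGrading k 𝒜 0, ∃ d : k, b * η j = d • η j := by
    refine ⟨fun j => MulOpposite.op (ε j), fun j => op_mem_opGrading (hε₀ j), fun j => ?_, ?_,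
      fun j b hb => ⟨c j b.unop, ?_⟩⟩
    · rw [← MulOpposite.op_mul, hε]
    · rw [← Finset.op_sum, hε1, MulOpposite.op_one]
    · rw [← MulOpposite.op_smul, ← hεr j _ (unop_mem_of_mem_opGrading hb), MulOpposite.op_mul,
        MulOpposite.op_unop]
  have hopA := opGrading_isInternal hA
  have hopA₀ := opGrading_eq_bot hA₀
  have hopmul : ∀ {i j : ℤ} {a b : Aᵐᵒᵖ}, a ∈ opGrading k 𝒜 i → b ∈ opGrading k 𝒜 j →
      a * b ∈ opGrading k 𝒜 (i + j) := opGrading_mul_mem hmul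
  exact ⟨GrMod.SDetermined.of_bar h1 hA hA₀ hmul ε hε₀ hε hε1 c hεl hc hc0 hopA hopA₀ hopmul
      η hη₀ hη hη1 hηk hMp hM₀,
    GrMod.SDetermined.bar h1 hA hA₀ hmul ε c hc hc0 hMp⟩
end
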